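/- Lower bound on the number of collisions: for the KCIP on the torus Λ(L,d) with parameter p=c/n (d≥3), for every ε>0 there exist constants κ>0 and C<∞ (depending only on ε, c, d, not on n) and N such that for all n>N and every initial configuration x: E_x[ #{0 ≤ u < ⌊εn³⌋ : Y_{u+1} < Y_u} ] ≥ κ·Y_0(x) − C. -/

import Mathlib

open scoped Classical
open Finset

noncomputable section

/-- The number of particles (vertices labelled `1`) of a configuration. -/
def numParticles {V : Type*} [Fintype V] (x : V → Bool) : ℕ :=
  (Finset.univ.filter fun v => x v = true).card

/-- One-step transition kernel of the kinetically constrained Ising process (KCIP)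
on the graph `G` with density parameter `p`: a uniformly chosen vertex `v` is updated,
and its label is resampled (to `1` with probability `p`, to `0` otherwise) iff `v` has at
least one neighbour labelled `1`. -/
def kcipKernel {V : Type*} [Fintype V] (G : SimpleGraph V) (p : ℝ) (x y : V → Bool) : ℝ :=
  ((Fintype.card V : ℝ))⁻¹ * ∑ v : V,
    (if ∀ w, w ≠ v → y w = x w then
      (if ∃ u, G.Adj u v ∧ x u = true then (if y v = true then p else 1 - p)
       else (if y v = x v then 1 else 0))
     else 0)

/-- Probability that the Markov chain with kernel `K` started at `x` produces a
trajectory `(X_0, …, X_T)` lying in the event `A`. -/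
def trajProb {Ω : Type*} [Fintype Ω] (K : Ω → Ω → ℝ) (x : Ω) (T : ℕ)
    (A : (Fin (T + 1) → Ω) → Prop) : ℝ :=
  ∑ ω : Fin (T + 1) → Ω,
    if ω 0 = x ∧ A ω then ∏ i : Fin T, K (ω i.castSucc) (ω i.succ) else 0

/-- Expectation of a functional `f` of the trajectory `(X_0, …, X_T)` of the Markov chain
with kernel `K` started at `x`. -/
def trajExp {Ω : Type*} [Fintype Ω] (K : Ω → Ω → ℝ) (x : Ω) (T : ℕ)
    (f : (Fin (T + 1) → Ω) → ℝ) : ℝ :=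
  ∑ ω : Fin (T + 1) → Ω,
    (if ω 0 = x then ∏ i : Fin T, K (ω i.castSucc) (ω i.succ) else 0) * f ω

/-- The `d`-dimensional discrete torus `Z_L^d`: vertices are `Fin d → ZMod L`, with an edge
between `u` and `v` iff `u - v = ± e_i` for some coordinate vector `e_i`. -/
def torusGraph (L d : ℕ) : SimpleGraph (Fin d → ZMod L) :=
  SimpleGraph.fromRel fun u v => ∃ i : Fin d, v = u + fun j => if j = i then (1 : ZMod L) else 0

/-- Number of connected components of the subgraph of `G` induced by the particles of `x`. -/
def numComponents {V : Type*} [Fintype V] (G : SimpleGraph V) (x : V → Bool) : ℕ :=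
  Nat.card (G.induce {v | x v = true}).ConnectedComponent

theorem numComponents_update_lt {V : Type*} [Fintype V] (G : SimpleGraph V) (x : V → Bool)
    (C : Set V) (hC : ∀ u ∈ C, ∀ w, G.Adj u w → x w = true → w ∈ C) {z u₁ u₂ : V}
    (hz : x z = false) (hu₁ : u₁ ∈ C) (ha₁ : G.Adj u₁ z) (hx₁ : x u₁ = true)
    (hu₂ : u₂ ∉ C) (ha₂ : G.Adj u₂ z) (hx₂ : x u₂ = true) :
    numComponents G (Function.update x z true) < numComponents G x := by
  set y := Function.update x z true with hy
  have hyz : y z = true := by simp [hy]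
  have hsub : {v | x v = true} ⊆ {v | y v = true} := by
    intro v hv
    by_cases h : v = z
    · subst h; exact hyz
    · simpa [hy, Function.update_of_ne h] using hv
  let φ : G.induce {v | x v = true} →g G.induce {v | y v = true} :=
    (G.induceHomOfLE hsub).toHom
  have hφ (v : V) (hv : x v = true) : φ ⟨v, hv⟩ = ⟨v, hsub hv⟩ := rfl
  have key : ∀ (u : V) (hu : x u = true), G.Adj u z →
      (G.induce {v | y v = true}).connectedComponentMk (φ ⟨u, hu⟩)
        = (G.induce {v | y v = true}).connectedComponentMk ⟨z, hyz⟩ := by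
    intro u hu hadj
    apply SimpleGraph.ConnectedComponent.sound
    apply SimpleGraph.Adj.reachable
    simpa [hφ] using hadj
  have hsurj : Function.Surjective (SimpleGraph.ConnectedComponent.map φ) := by
    intro c
    induction c using SimpleGraph.ConnectedComponent.ind with
    | h v =>
      obtain ⟨v, hv⟩ := v
      by_cases h : v = z
      · subst h
        refine ⟨(G.induce {v | x v = true}).connectedComponentMk ⟨u₁, hx₁⟩, ?_⟩
        rw [SimpleGraph.ConnectedComponent.map_mk, key u₁ hx₁ ha₁]
      · have hxv : x v = true := by simpa [hy, Function.update_of_ne h] using hv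
        exact ⟨(G.induce {v | x v = true}).connectedComponentMk ⟨v, hxv⟩, rfl⟩
  have hstay : ∀ a b : {v | x v = true}, (G.induce {v | x v = true}).Reachable a b →
      a.1 ∈ C → b.1 ∈ C := by
    rintro a b ⟨w⟩
    induction w with
    | nil => exact id
    | @cons a b c h _ ih => exact fun ha => ih (hC _ ha _ h b.2)
  have hninj : ¬ Function.Injective (SimpleGraph.ConnectedComponent.map φ) := by
    intro hinj
    have : (G.induce {v | x v = true}).connectedComponentMk ⟨u₁, hx₁⟩
        = (G.induce {v | x v = true}).connectedComponentMk ⟨u₂, hx₂⟩ := by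
      apply hinj
      rw [SimpleGraph.ConnectedComponent.map_mk, SimpleGraph.ConnectedComponent.map_mk,
        key u₁ hx₁ ha₁, key u₂ hx₂ ha₂]
    exact hu₂ (hstay _ _ (SimpleGraph.ConnectedComponent.exact this) hu₁)
  unfold numComponents
  rw [Nat.card_eq_fintype_card, Nat.card_eq_fintype_card]
  exact Fintype.card_lt_of_surjective_not_injective _ hsurj hninj

theorem sum_kcipKernel_mul {V : Type*} [Fintype V] (G : SimpleGraph V) (p : ℝ) (x : V → Bool)
    (H : (V → Bool) → ℝ) :
    ∑ y, kcipKernel G p x y * H y = ((Fintype.card V : ℝ))⁻¹ * ∑ v : V,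
      if ∃ u, G.Adj u v ∧ x u = true then
        p * H (Function.update x v true) + (1 - p) * H (Function.update x v false)
      else H x := by
  simp only [kcipKernel, mul_assoc, ← Finset.mul_sum, Finset.sum_mul]
  congr 1
  rw [Finset.sum_comm]
  refine Finset.sum_congr rfl fun v _ => ?_
  have hne : Function.update x v true ≠ Function.update x v false := by
    intro h
    simpa using congrFun h v
  rw [← Finset.sum_subset (Finset.subset_univ
    {Function.update x v true, Function.update x v false}), Finset.sum_pair hne]
  · have h1 : ∀ b, ∀ w, w ≠ v → Function.update x v b w = x w :=
      fun b w hw => Function.update_of_ne hw _ _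
    rw [if_pos (h1 true), if_pos (h1 false)]
    simp only [Function.update_self, if_true, Bool.false_eq_true, if_false]
    by_cases h : ∃ u, G.Adj u v ∧ x u = true
    · simp only [if_pos h]
    · simp only [if_neg h]
      cases hx : x v with
      | true =>
        have : Function.update x v true = x := by rw [← hx]; simp
        simp [this]
      | false =>
        have : Function.update x v false = x := by rw [← hx]; simp
        simp [this]
  · intro y _ hy
    rw [if_neg, zero_mul]
    intro h
    apply hy
    have : y = Function.update x v (y v) := by
      ext w
      by_cases hw : w = v
      · subst hw; simp
      · rw [Function.update_of_ne hw, h w hw]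
    rw [this]
    cases y v <;> simp

theorem trajExp_succ {Ω : Type*} [Fintype Ω] (K : Ω → Ω → ℝ) (x : Ω) (T : ℕ)
    (F : (Fin (T + 1 + 1) → Ω) → ℝ) :
    trajExp K x (T + 1) F = ∑ y, K x y * trajExp K y T (fun ω => F (Fin.cons x ω)) := by
  unfold trajExp
  rw [← (Fin.consEquiv fun _ => Ω).sum_comp, Fintype.sum_prod_type, Finset.sum_eq_single x]
  · simp only [Fin.consEquiv_apply, Fin.cons_zero, if_true, Finset.mul_sum]
    rw [Finset.sum_comm]
    refine Finset.sum_congr rfl fun ω _ => ?_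
    rw [Finset.sum_eq_single (ω 0)]
    · rw [Fin.prod_univ_succ]
      simp only [if_true, Fin.consEquiv, Equiv.coe_fn_mk, Fin.castSucc_zero, Fin.cons_zero,
        Fin.cons_succ, Fin.castSucc_succ, mul_assoc]
    · intro y _ hy
      rw [if_neg (Ne.symm hy)]; ring
    · simp
  · intro y _ hy
    simp [hy]
  · simp

theorem trajExp_zero {Ω : Type*} [Fintype Ω] (K : Ω → Ω → ℝ) (x : Ω)
    (F : (Fin (0 + 1) → Ω) → ℝ) : trajExp K x 0 F = F (fun _ => x) := by
  unfold trajExp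
  rw [Finset.sum_eq_single (fun _ => x)]
  · simp
  · intro ω _ hω
    rw [if_neg, zero_mul]
    intro h
    apply hω
    ext i
    rw [Fin.fin_one_eq_zero i, h]
  · simp

theorem trajExp_add_initial {Ω : Type*} [Fintype Ω] (K : Ω → Ω → ℝ)
    (hK : ∀ x, ∑ y, K x y = 1) (T : ℕ) :
    ∀ (x : Ω) (h : Ω → ℝ) (F : (Fin (T + 1) → Ω) → ℝ),
    trajExp K x T (fun ω => h (ω 0) + F ω) = h x + trajExp K x T F := by
  have hone : ∀ (T : ℕ) (x : Ω), trajExp K x T (fun _ => 1) = 1 := by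
    intro T
    induction T with
    | zero => intro x; exact trajExp_zero K x _
    | succ T ih => intro x; rw [trajExp_succ]; simp [ih, hK]
  intro x h F
  have h1 : trajExp K x T (fun ω => h (ω 0) + F ω)
      = h x * trajExp K x T (fun _ => 1) + trajExp K x T F := by
    unfold trajExp
    rw [Finset.mul_sum, ← Finset.sum_add_distrib]
    refine Finset.sum_congr rfl fun ω _ => ?_
    split_ifs with h0
    · simp only [h0]; ring
    · ring
  rw [h1, hone, mul_one]

/-- Expected number of steps `u < T` with `Y (X_{u+1}) < Y (X_u)`. -/
def expDrops {Ω : Type*} [Fintype Ω] (K : Ω → Ω → ℝ) (Y : Ω → ℕ) (x : Ω) (T : ℕ) : ℝ :=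
  trajExp K x T fun ω =>
    ((Finset.univ.filter fun u : Fin T => Y (ω u.succ) < Y (ω u.castSucc)).card : ℝ)

theorem expDrops_zero {Ω : Type*} [Fintype Ω] (K : Ω → Ω → ℝ) (Y : Ω → ℕ) (x : Ω) :
    expDrops K Y x 0 = 0 := by
  unfold expDrops; rw [trajExp_zero]; simp

theorem expDrops_succ {Ω : Type*} [Fintype Ω] (K : Ω → Ω → ℝ)
    (hK : ∀ x, ∑ y, K x y = 1) (Y : Ω → ℕ) (x : Ω) (T : ℕ) :
    expDrops K Y x (T + 1)
      = ∑ y, K x y * ((if Y y < Y x then 1 else 0) + expDrops K Y y T) := by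
  unfold expDrops
  rw [trajExp_succ]
  refine Finset.sum_congr rfl fun y _ => ?_
  congr 1
  rw [← trajExp_add_initial K hK T y (fun y => if Y y < Y x then 1 else 0)]
  congr 1
  ext ω
  rw [Finset.card_filter, Fin.sum_univ_succ, Finset.card_filter]
  push_cast
  simp

theorem expDrops_nonneg {Ω : Type*} [Fintype Ω] (K : Ω → Ω → ℝ) (hK : ∀ x y, 0 ≤ K x y)
    (Y : Ω → ℕ) (x : Ω) (T : ℕ) : 0 ≤ expDrops K Y x T := by
  unfold expDrops trajExp
  refine Finset.sum_nonneg fun ω _ => mul_nonneg ?_ (Nat.cast_nonneg _)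
  split_ifs
  · exact Finset.prod_nonneg fun i _ => hK _ _
  · exact le_rfl

theorem sum_kcipKernel {V : Type*} [Fintype V] [Nonempty V] (G : SimpleGraph V) (p : ℝ)
    (x : V → Bool) : ∑ y, kcipKernel G p x y = 1 := by
  have h := sum_kcipKernel_mul G p x (fun _ => 1)
  simp only [mul_one] at h
  rw [h]
  have hV : (Fintype.card V : ℝ) ≠ 0 := by exact_mod_cast Fintype.card_ne_zero
  simp [hV]

theorem kcipKernel_nonneg {V : Type*} [Fintype V] (G : SimpleGraph V) {p : ℝ} (h0 : 0 ≤ p)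
    (h1 : p ≤ 1) (x y : V → Bool) : 0 ≤ kcipKernel G p x y := by
  unfold kcipKernel
  refine mul_nonneg (by positivity) (Finset.sum_nonneg fun v _ => ?_)
  split_ifs <;> linarith

/-- The occupied neighbours of `a` in the configuration `x`. -/
def occNbrs {V : Type*} [Fintype V] (G : SimpleGraph V) (x : V → Bool) (a : V) : Finset V :=
  Finset.univ.filter fun w => G.Adj a w ∧ x w = true

/-- The component of `a` in the configuration `x` consists of exactly two adjacent vertices. -/
def IsPair {V : Type*} [Fintype V] (G : SimpleGraph V) (x : V → Bool) (a : V) : Prop :=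
  ∃ w, occNbrs G x a = {w} ∧ occNbrs G x w = {a}

/-- The indicator function of the vertex `a`. -/
def pointMass {V : Type*} (a : V) (s : V) : ℝ := if s = a then 1 else 0

/-- The sub-probability weight attached to a tagged particle at `a`: a unit mass if `a` is
isolated, roughly uniform on the component if it is a pair, and a small multiple of a unit mass
in all other cases. -/
def tagWeight {V : Type*} [Fintype V] (G : SimpleGraph V) (η : ℝ) (x : V → Bool) (a s : V) : ℝ :=
  if occNbrs G x a = ∅ then pointMass a s
  else if IsPair G x a then
    (1 - η) / 2 * (pointMass a s + ∑ w ∈ occNbrs G x a, pointMass w s)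
  else (1 / 4) ^ (occNbrs G x a).card * pointMass a s

/-- A lower bound for the weight of the particle tagged at `a` after the label of `v` has been
set to `b`, as long as the other components of `x` do not interfere. -/
def jumpWeight {V : Type*} [Fintype V] (G : SimpleGraph V) (η : ℝ) (x : V → Bool) (a v : V)
    (b : Bool) (s : V) : ℝ :=
  if x v = b then tagWeight G η x a s
  else if b = true then
    if occNbrs G x a = ∅ then
      if G.Adj a v then (1 - η) / 2 * (pointMass a s + pointMass v s) else tagWeight G η x a s
    else if G.Adj a v then 0
    else if IsPair G x a ∧ ∃ w ∈ occNbrs G x a, G.Adj w v then 0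
    else tagWeight G η x a s
  else
    if v = a then if IsPair G x a then ∑ w ∈ occNbrs G x a, pointMass w s else 0
    else if v ∈ occNbrs G x a then
      if IsPair G x a then pointMass a s
      else (1 / 4) ^ ((occNbrs G x a).card - 1) * pointMass a s
    else tagWeight G η x a s

theorem pointMass_nonneg {V : Type*} (a s : V) : 0 ≤ pointMass a s := by
  unfold pointMass; split_ifs <;> norm_num

theorem sum_pointMass_mul {V : Type*} [Fintype V] (a : V) (g : V → ℝ) :
    ∑ s, pointMass a s * g s = g a := by
  simp [pointMass]

theorem mem_occNbrs {V : Type*} [Fintype V] {G : SimpleGraph V} {x : V → Bool} {a w : V} :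
    w ∈ occNbrs G x a ↔ G.Adj a w ∧ x w = true := by
  simp [occNbrs]

section Drift

variable {V : Type*} [Fintype V] {G : SimpleGraph V} {k : ℕ} {p η rate mu : ℝ}

theorem drift_tagWeight_isolated (hk : ∀ a, (Finset.univ.filter (G.Adj a)).card ≤ k)
    (hp0 : 0 ≤ p) (hη0 : 0 ≤ η) (hη1 : η ≤ 1 / 2)
    (h3 : rate ≤ p * ((1 - η) / 2 * mu - η * k))
    {x : V → Bool} {a : V} (hxa : x a = true) {g : V → ℝ} (hg : ∀ s, 0 ≤ g s)
    (hN : occNbrs G x a = ∅)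
    (hsub : mu * g a ≤ ∑ v ∈ Finset.univ.filter (G.Adj a), (g v - g a)) :
    rate * ∑ s, tagWeight G η x a s * g s ≤
      ∑ v, if ∃ u, G.Adj u v ∧ x u = true then
        p * (∑ s, jumpWeight G η x a v true s * g s - ∑ s, tagWeight G η x a s * g s)
        + (1 - p) * (∑ s, jumpWeight G η x a v false s * g s - ∑ s, tagWeight G η x a s * g s)
        else 0 := by
  have ht : ∑ s, tagWeight G η x a s * g s = g a := by
    simp only [tagWeight, if_pos hN, sum_pointMass_mul]
  have hterm : ∀ v, (if ∃ u, G.Adj u v ∧ x u = true then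
        p * (∑ s, jumpWeight G η x a v true s * g s - ∑ s, tagWeight G η x a s * g s)
        + (1 - p) * (∑ s, jumpWeight G η x a v false s * g s - ∑ s, tagWeight G η x a s * g s)
        else 0) = if G.Adj a v then p * ((1 - η) / 2 * (g a + g v) - g a) else 0 := by
    intro v
    have hnb : G.Adj a v → x v = false := by
      intro h
      by_contra hc
      have : v ∈ occNbrs G x a := mem_occNbrs.2 ⟨h, by simpa using hc⟩
      simp [hN] at this
    by_cases hav : G.Adj a v
    · have hxv := hnb hav
      rw [if_pos ⟨a, hav, hxa⟩, if_pos hav, ht]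
      have h1 : ∑ s, jumpWeight G η x a v true s * g s = (1 - η) / 2 * (g a + g v) := by
        simp [jumpWeight, hxv, hN, hav, mul_assoc, ← Finset.mul_sum, add_mul,
          Finset.sum_add_distrib, sum_pointMass_mul]
      have h2 : ∑ s, jumpWeight G η x a v false s * g s = g a := by
        simp [jumpWeight, hxv, ht]
      rw [h1, h2]; ring
    · rw [if_neg hav]
      split_ifs with hact
      · have h1 : ∑ s, jumpWeight G η x a v true s * g s = g a := by
          simp [jumpWeight, hN, hav, ht]
        have hva : v ≠ a := by
          rintro rfl
          obtain ⟨u, hu, hxu⟩ := hact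
          have : u ∈ occNbrs G x v := mem_occNbrs.2 ⟨hu.symm, hxu⟩
          simp [hN] at this
        have h2 : ∑ s, jumpWeight G η x a v false s * g s = g a := by
          simp [jumpWeight, hN, hva, ht]
        rw [h1, h2, ht]; ring
      · rfl
  simp only [hterm]
  rw [ht, ← Finset.sum_filter, ← Finset.mul_sum]
  have hsum : ∑ v ∈ Finset.univ.filter (G.Adj a), ((1 - η) / 2 * (g a + g v) - g a)
      = (1 - η) / 2 * ∑ v ∈ Finset.univ.filter (G.Adj a), (g v - g a)
        - η * g a * (Finset.univ.filter (G.Adj a)).card := by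
    rw [Finset.mul_sum, Finset.card_eq_sum_ones]
    push_cast
    rw [Finset.mul_sum, ← Finset.sum_sub_distrib]
    refine Finset.sum_congr rfl fun v _ => by ring
  rw [hsum]
  have hkc : ((Finset.univ.filter (G.Adj a)).card : ℝ) ≤ k := by exact_mod_cast hk a
  have e1 : η * g a * (Finset.univ.filter (G.Adj a)).card ≤ η * g a * k :=
    mul_le_mul_of_nonneg_left hkc (mul_nonneg hη0 (hg a))
  have e2 : (1 - η) / 2 * (mu * g a) ≤
      (1 - η) / 2 * ∑ v ∈ Finset.univ.filter (G.Adj a), (g v - g a) :=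
    mul_le_mul_of_nonneg_left hsub (by linarith)
  calc rate * g a ≤ p * ((1 - η) / 2 * mu - η * k) * g a :=
        mul_le_mul_of_nonneg_right h3 (hg a)
    _ = p * ((1 - η) / 2 * (mu * g a) - η * g a * k) := by ring
    _ ≤ _ := mul_le_mul_of_nonneg_left (by linarith) hp0

theorem tagWeight_nonneg (hη1 : η ≤ 1 / 2) (x : V → Bool) (a s : V) :
    0 ≤ tagWeight G η x a s := by
  unfold tagWeight
  have h1 := pointMass_nonneg a s
  split_ifs
  · exact h1
  · refine mul_nonneg (by linarith) (add_nonneg h1 (Finset.sum_nonneg fun w _ => ?_))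
    exact pointMass_nonneg w s
  · exact mul_nonneg (by positivity) h1

theorem jumpWeight_nonneg (hη1 : η ≤ 1 / 2) (x : V → Bool) (a v : V) (b : Bool) (s : V) :
    0 ≤ jumpWeight G η x a v b s := by
  have h0 := tagWeight_nonneg (G := G) hη1 x a s
  have h1 := pointMass_nonneg a s
  have h2 := pointMass_nonneg v s
  have h3 : 0 ≤ ∑ w ∈ occNbrs G x a, pointMass w s :=
    Finset.sum_nonneg fun w _ => pointMass_nonneg w s
  unfold jumpWeight
  split_ifs
  all_goals first | exact h0 | exact h1 | exact h3 | exact le_rfl | skip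
  · exact mul_nonneg (by linarith) (add_nonneg h1 h2)
  · exact mul_nonneg (by positivity) h1

theorem drift_tagWeight_pair (hk : ∀ a, (Finset.univ.filter (G.Adj a)).card ≤ k)
    (hp0 : 0 ≤ p) (hp1 : p ≤ 1 / 2) (hη0 : 0 ≤ η) (hη1 : η ≤ 1 / 2)
    (h1 : rate ≤ η - 2 * k * p)
    {x : V → Bool} {a : V} (hxa : x a = true) {g : V → ℝ} (hg : ∀ s, 0 ≤ g s)
    (hP : IsPair G x a) :
    rate * ∑ s, tagWeight G η x a s * g s ≤
      ∑ v, if ∃ u, G.Adj u v ∧ x u = true then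
        p * (∑ s, jumpWeight G η x a v true s * g s - ∑ s, tagWeight G η x a s * g s)
        + (1 - p) * (∑ s, jumpWeight G η x a v false s * g s - ∑ s, tagWeight G η x a s * g s)
        else 0 := by
  obtain ⟨w, hNa, hNw⟩ := id hP
  have hw : G.Adj a w ∧ x w = true := mem_occNbrs.1 (by simp [hNa])
  have hN : occNbrs G x a ≠ ∅ := by simp [hNa]
  have hwa : w ≠ a := hw.1.ne'
  set t := ∑ s, tagWeight G η x a s * g s with htdef
  have ht : t = (1 - η) / 2 * (g a + g w) := by
    rw [htdef]
    simp [tagWeight, hP, hNa, mul_assoc, ← Finset.mul_sum, add_mul,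
          Finset.sum_add_distrib, sum_pointMass_mul]
  have hga := hg a
  have hgw := hg w
  have ht0 : 0 ≤ t := by rw [ht]; exact mul_nonneg (by linarith) (by linarith)
  have hterm : ∀ v, (if v = a then (1 - p) * (g w - t) else 0)
        + (if v = w then (1 - p) * (g a - t) else 0)
        + ((if G.Adj a v then - (p * t) else 0) + (if G.Adj w v then - (p * t) else 0)) ≤
      (if ∃ u, G.Adj u v ∧ x u = true then
        p * (∑ s, jumpWeight G η x a v true s * g s - t)
        + (1 - p) * (∑ s, jumpWeight G η x a v false s * g s - t)
        else 0) := by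
    intro v
    have hpt : 0 ≤ p * t := mul_nonneg hp0 ht0
    by_cases hact : ∃ u, G.Adj u v ∧ x u = true
    · rw [if_pos hact]
      cases hxv : x v with
      | true =>
        have e1 : ∑ s, jumpWeight G η x a v true s * g s = t := by
          simp [jumpWeight, hxv, htdef]
        rw [e1]
        by_cases hva : v = a
        · subst hva
          have e2 : ∑ s, jumpWeight G η x v v false s * g s = g w := by
            simp [jumpWeight, hxv, hP, hNa, sum_pointMass_mul]
          rw [e2]
          simp [hwa.symm, hw.1.symm]
          linarith
        · by_cases hvw : v = w
          · subst hvw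
            have e2 : ∑ s, jumpWeight G η x a v false s * g s = g a := by
              simp [jumpWeight, hxv, hP, hNa, hva, sum_pointMass_mul]
            rw [e2]
            simp [hva, hw.1]
            linarith
          · have e2 : ∑ s, jumpWeight G η x a v false s * g s = t := by
              simp [jumpWeight, hxv, hNa, hva, hvw, htdef]
            rw [e2]
            simp only [hva, hvw, if_false]
            split_ifs <;> linarith
      | false =>
        have e2 : ∑ s, jumpWeight G η x a v false s * g s = t := by
          simp [jumpWeight, hxv, htdef]
        rw [e2]
        have hva : v ≠ a := by rintro rfl; simp [hxv] at hxa
        have hvw : v ≠ w := by rintro rfl; simp [hxv] at hw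
        simp only [hva, hvw, if_false]
        by_cases hav : G.Adj a v ∨ G.Adj w v
        · have e1 : 0 ≤ ∑ s, jumpWeight G η x a v true s * g s :=
            Finset.sum_nonneg fun s _ => mul_nonneg (jumpWeight_nonneg hη1 _ _ _ _ _) (hg s)
          have e3 : 0 ≤ p * ∑ s, jumpWeight G η x a v true s * g s := mul_nonneg hp0 e1
          rcases hav with h | h
          · simp only [h, if_true]
            split_ifs <;> linarith
          · simp only [h, if_true]
            split_ifs <;> linarith
        · push Not at hav
          have e1 : ∑ s, jumpWeight G η x a v true s * g s = t := by
            simp [jumpWeight, hxv, hNa, hav.1, hav.2, htdef]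
          rw [e1]
          simp [hav.1, hav.2]
    · rw [if_neg hact]
      push Not at hact
      have hav : ¬ G.Adj a v := fun h => hact a h hxa
      have hwv : ¬ G.Adj w v := fun h => hact w h hw.2
      have hva : v ≠ a := by rintro rfl; exact hact w hw.1.symm hw.2
      have hvw : v ≠ w := by rintro rfl; exact hact a hw.1 hxa
      simp [hav, hwv, hva, hvw]
  refine le_trans ?_ (Finset.sum_le_sum fun v _ => hterm v)
  rw [Finset.sum_add_distrib, Finset.sum_add_distrib, Finset.sum_add_distrib]
  rw [← Finset.sum_filter (fun v => G.Adj a v), ← Finset.sum_filter (fun v => G.Adj w v)]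
  simp only [Finset.sum_ite_eq', Finset.mem_univ, if_true, Finset.sum_const, nsmul_eq_mul]
  have hka : ((Finset.univ.filter (G.Adj a)).card : ℝ) ≤ k := by exact_mod_cast hk a
  have hkw : ((Finset.univ.filter (G.Adj w)).card : ℝ) ≤ k := by exact_mod_cast hk w
  have hpt : 0 ≤ p * t := mul_nonneg hp0 ht0
  have f1 := mul_le_mul_of_nonneg_right hka hpt
  have f2 := mul_le_mul_of_nonneg_right hkw hpt
  have f3 : rate * t ≤ (η - 2 * k * p) * t := mul_le_mul_of_nonneg_right h1 ht0
  have f4 : η * t ≤ (1 - p) * (g w - t) + (1 - p) * (g a - t) := by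
    have e : g w + g a - 2 * t = η * (g a + g w) := by rw [ht]; ring
    have e2 : t ≤ (1 - p) * (g a + g w) := by
      rw [ht]; exact mul_le_mul_of_nonneg_right (by linarith) (by linarith)
    have e3 := mul_le_mul_of_nonneg_left e2 hη0
    calc η * t ≤ η * ((1 - p) * (g a + g w)) := e3
      _ = (1 - p) * (g w + g a - 2 * t) := by rw [e]; ring
      _ = _ := by ring
  linarith

theorem drift_tagWeight_large (hk : ∀ a, (Finset.univ.filter (G.Adj a)).card ≤ k)
    (hp0 : 0 ≤ p) (hp1 : p ≤ 1 / 2) (hη1 : η ≤ 1 / 2)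
    (h2 : rate ≤ 1 - k * p)
    {x : V → Bool} {a : V} (hxa : x a = true) {g : V → ℝ} (hg : ∀ s, 0 ≤ g s)
    (hN : occNbrs G x a ≠ ∅) (hP : ¬ IsPair G x a) :
    rate * ∑ s, tagWeight G η x a s * g s ≤
      ∑ v, if ∃ u, G.Adj u v ∧ x u = true then
        p * (∑ s, jumpWeight G η x a v true s * g s - ∑ s, tagWeight G η x a s * g s)
        + (1 - p) * (∑ s, jumpWeight G η x a v false s * g s - ∑ s, tagWeight G η x a s * g s)
        else 0 := by
  set t := ∑ s, tagWeight G η x a s * g s with htdef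
  set m := (occNbrs G x a).card with hm
  have hm1 : 1 ≤ m := Finset.card_pos.2 (Finset.nonempty_iff_ne_empty.2 hN)
  have ht : t = (1 / 4) ^ m * g a := by
    rw [htdef]
    simp only [tagWeight, hN, hP, if_false, mul_assoc, ← Finset.mul_sum, sum_pointMass_mul, hm]
  have hga := hg a
  have ht0 : 0 ≤ t := by rw [ht]; positivity
  have hpt : 0 ≤ p * t := mul_nonneg hp0 ht0
  have hpt' : 0 ≤ (1 - p) * t := mul_nonneg (by linarith) ht0
  obtain ⟨w0, hw0⟩ := Finset.nonempty_iff_ne_empty.2 hN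
  rw [mem_occNbrs] at hw0
  have hterm : ∀ v, (if v = a then - ((1 - p) * t) else 0)
        + (if v ∈ occNbrs G x a then (1 - p) * (3 * t) else 0)
        + (if G.Adj a v then - (p * t) else 0) ≤
      (if ∃ u, G.Adj u v ∧ x u = true then
        p * (∑ s, jumpWeight G η x a v true s * g s - t)
        + (1 - p) * (∑ s, jumpWeight G η x a v false s * g s - t)
        else 0) := by
    intro v
    have j0 : ∀ b, 0 ≤ ∑ s, jumpWeight G η x a v b s * g s := fun b =>
            Finset.sum_nonneg fun s _ => mul_nonneg (jumpWeight_nonneg hη1 _ _ _ _ _) (hg s)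
    have j1 := mul_nonneg hp0 (j0 true)
    have j2 := mul_nonneg (show 0 ≤ 1 - p by linarith) (j0 false)
    by_cases hact : ∃ u, G.Adj u v ∧ x u = true
    · rw [if_pos hact]
      cases hxv : x v with
      | true =>
        have e1 : ∑ s, jumpWeight G η x a v true s * g s = t := by
          simp [jumpWeight, hxv, htdef]
        rw [e1]
        by_cases hva : v = a
        · subst hva
          have : v ∉ occNbrs G x v := by simp [mem_occNbrs]
          simp only [if_true, this, if_false, G.irrefl]
          linarith
        · by_cases hvN : v ∈ occNbrs G x a
          · have e2 : ∑ s, jumpWeight G η x a v false s * g s = 4 * t := by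
              simp only [jumpWeight, hxv, hP, hva, hvN, if_true, if_false,
                Bool.false_eq_true, Bool.true_eq_false, mul_assoc, ← Finset.mul_sum,
                sum_pointMass_mul, ht, ← hm]
              obtain ⟨m', hm'⟩ := Nat.exists_eq_add_of_le' hm1
              rw [hm', Nat.add_sub_cancel, pow_succ]
              ring
            rw [e2]
            simp only [hva, hvN, if_false, if_true]
            split_ifs <;> linarith
          · have e2 : ∑ s, jumpWeight G η x a v false s * g s = t := by
              simp [jumpWeight, hxv, hva, hvN, htdef]
            rw [e2]
            simp only [hva, hvN, if_false]
            split_ifs <;> linarith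
      | false =>
        have e2 : ∑ s, jumpWeight G η x a v false s * g s = t := by
          simp [jumpWeight, hxv, htdef]
        rw [e2]
        have hva : v ≠ a := by rintro rfl; simp [hxv] at hxa
        have hvN : v ∉ occNbrs G x a := by simp [mem_occNbrs, hxv]
        simp only [hva, hvN, if_false]
        by_cases hav : G.Adj a v
        · simp only [hav, if_true]
          linarith
        · have e1 : ∑ s, jumpWeight G η x a v true s * g s = t := by
            simp [jumpWeight, hN, hxv, hav, hP, htdef]
          rw [e1]
          simp [hav]
    · rw [if_neg hact]
      push Not at hact
      have hav : ¬ G.Adj a v := fun h => hact a h hxa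
      have hva : v ≠ a := by rintro rfl; exact hact w0 hw0.1.symm hw0.2
      have hvN : v ∉ occNbrs G x a := by simp [mem_occNbrs, hav]
      simp [hav, hva, hvN]
  refine le_trans ?_ (Finset.sum_le_sum fun v _ => hterm v)
  rw [Finset.sum_add_distrib, Finset.sum_add_distrib]
  rw [← Finset.sum_filter (fun v => G.Adj a v)]
  simp only [Finset.sum_ite_eq', Finset.sum_ite_mem, Finset.univ_inter, Finset.mem_univ, if_true,
    Finset.sum_const, nsmul_eq_mul]
  rw [← hm]
  have hka : ((Finset.univ.filter (G.Adj a)).card : ℝ) ≤ k := by exact_mod_cast hk a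
  have f1 := mul_le_mul_of_nonneg_right hka hpt
  have f3 : rate * t ≤ (1 - k * p) * t := mul_le_mul_of_nonneg_right h2 ht0
  have hm2 : (1 : ℝ) ≤ m := by exact_mod_cast hm1
  have f4 : 1 * ((1 - p) * (3 * t)) ≤ m * ((1 - p) * (3 * t)) :=
    mul_le_mul_of_nonneg_right hm2 (by linarith)
  have f5 : p * t ≤ 1 / 2 * t := mul_le_mul_of_nonneg_right hp1 ht0
  linarith

theorem drift_tagWeight (hk : ∀ a, (Finset.univ.filter (G.Adj a)).card ≤ k)
    (hp0 : 0 ≤ p) (hp1 : p ≤ 1 / 2) (hη0 : 0 ≤ η) (hη1 : η ≤ 1 / 2)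
    (h1 : rate ≤ η - 2 * k * p) (h2 : rate ≤ 1 - k * p)
    (h3 : rate ≤ p * ((1 - η) / 2 * mu - η * k))
    {x : V → Bool} {a : V} (hxa : x a = true) {g : V → ℝ} (hg : ∀ s, 0 ≤ g s)
    (hsub : mu * g a ≤ ∑ v ∈ Finset.univ.filter (G.Adj a), (g v - g a)) :
    rate * ∑ s, tagWeight G η x a s * g s ≤
      ∑ v, if ∃ u, G.Adj u v ∧ x u = true then
        p * (∑ s, jumpWeight G η x a v true s * g s - ∑ s, tagWeight G η x a s * g s)
        + (1 - p) * (∑ s, jumpWeight G η x a v false s * g s - ∑ s, tagWeight G η x a s * g s)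
        else 0 := by
  by_cases hN : occNbrs G x a = ∅
  · exact drift_tagWeight_isolated hk hp0 hη0 hη1 h3 hxa hg hN hsub
  · by_cases hP : IsPair G x a
    · exact drift_tagWeight_pair hk hp0 hp1 hη0 hη1 h1 hxa hg hP
    · exact drift_tagWeight_large hk hp0 hp1 hη1 h2 hxa hg hN hP

end Drift

/-- The new position of a particle tagged at `a` when the configuration changes from `x` to `y`:
the tag stays in place as long as it can and otherwise moves to an occupied neighbour. -/
def moveTag {V : Type*} [Fintype V] (G : SimpleGraph V) (x y : V → Bool) (a : V) : V :=
  if y a = true then a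
  else if h : (occNbrs G x a).Nonempty then h.choose else a

theorem pow_card_mul_pointMass_le_tagWeight {V : Type*} [Fintype V] {G : SimpleGraph V} {η : ℝ}
    (hη1 : η ≤ 1 / 2) (x : V → Bool) (a s : V) :
    (1 / 4) ^ (occNbrs G x a).card * pointMass a s ≤ tagWeight G η x a s := by
  have h1 := pointMass_nonneg a s
  unfold tagWeight
  split_ifs with hN hP
  · simp [hN]
  · obtain ⟨w, hw, -⟩ := hP
    have h2 := pointMass_nonneg w s
    simp only [hw, Finset.card_singleton, pow_one, Finset.sum_singleton]
    have : 1 / 4 * pointMass a s ≤ (1 - η) / 2 * pointMass a s :=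
      mul_le_mul_of_nonneg_right (by linarith) h1
    have h3 : 0 ≤ (1 - η) / 2 * pointMass w s := mul_nonneg (by linarith) h2
    linarith
  · exact le_rfl

theorem jumpWeight_le_tagWeight {V : Type*} [Fintype V] {G : SimpleGraph V} {η : ℝ}
    (hη1 : η ≤ 1 / 2) {x : V → Bool} {a v : V} (hxa : x a = true)
    (b : Bool) (hiso : occNbrs G x a = ∅ → G.Adj a v → ∀ u, G.Adj u v → x u = true → u = a)
    (s : V) :
    jumpWeight G η x a v b s ≤
      tagWeight G η (Function.update x v b) (moveTag G x (Function.update x v b) a) s := by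
  set y := Function.update x v b with hy
  by_cases hxv : x v = b
  · have hyx : y = x := by rw [hy, ← hxv]; simp
    have hm : moveTag G x y a = a := by simp [moveTag, hyx, hxa]
    rw [hm, hyx]
    simp [jumpWeight, hxv]
  have hyne : ∀ w, w ≠ v → y w = x w := fun w hw => Function.update_of_ne hw _ _
  have hyv : y v = b := Function.update_self v b x
  have hsame : ∀ c, ¬ G.Adj c v → occNbrs G y c = occNbrs G x c := by
    intro c hc
    ext w
    simp only [mem_occNbrs]
    refine and_congr_right fun hw => ?_
    rw [hyne w (by rintro rfl; exact hc hw)]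
  have hpos := tagWeight_nonneg (G := G) hη1 y (moveTag G x y a) s
  cases b with
  | true =>
    have hxv' : x v = false := by simpa using hxv
    have hva : a ≠ v := by rintro rfl; simp [hxv'] at hxa
    have hm : moveTag G x y a = a := by simp [moveTag, hyne a hva, hxa]
    rw [hm] at hpos ⊢
    simp only [jumpWeight, if_neg hxv, if_true]
    split_ifs with hN hav hav hP
    · have h1 : occNbrs G y a = {v} := by
        ext w
        simp only [mem_occNbrs, Finset.mem_singleton]
        constructor
        · rintro ⟨haw, hyw⟩
          by_contra hw
          have : w ∈ occNbrs G x a := mem_occNbrs.2 ⟨haw, by rwa [hyne w hw] at hyw⟩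
          simp [hN] at this
        · rintro rfl; exact ⟨hav, hyv⟩
      have h2 : occNbrs G y v = {a} := by
        ext w
        simp only [mem_occNbrs, Finset.mem_singleton]
        constructor
        · rintro ⟨haw, hyw⟩
          rw [hyne w haw.ne'] at hyw
          exact hiso hN hav w haw.symm hyw
        · rintro rfl; exact ⟨hav.symm, by rw [hyne _ hva]; exact hxa⟩
      have hP : IsPair G y a := ⟨v, h1, h2⟩
      simp [tagWeight, h1, hP]
    · have h1 := hsame a hav
      simp [tagWeight, h1, hN]
    · exact hpos
    · exact hpos
    · have h1 := hsame a hav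
      by_cases hP' : IsPair G x a
      · obtain ⟨w, hw1, hw2⟩ := id hP'
        have hwv : ¬ G.Adj w v := fun h => hP ⟨hP', w, by simp [hw1], h⟩
        have hPy : IsPair G y a := ⟨w, by rw [h1, hw1], by rw [hsame w hwv, hw2]⟩
        simp [tagWeight, h1, hPy, hP']
      · rw [tagWeight, if_neg hN, if_neg hP', ← h1]
        exact pow_card_mul_pointMass_le_tagWeight hη1 y a s
  | false =>
    have hxv' : x v = true := by simpa using hxv
    simp only [jumpWeight, if_neg hxv, Bool.false_eq_true, if_false]
    split_ifs with hva hP hvN hP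
    · subst hva
      obtain ⟨w, hw1, hw2⟩ := hP
      have hne : (occNbrs G x v).Nonempty := by simp [hw1]
      have hm : moveTag G x y v = w := by
        have hmem : ∀ u ∈ occNbrs G x v, u = w := by simp [hw1]
        have hch := hmem _ hne.choose_spec
        simp [moveTag, hyv, hne, hch]
      have hempty : occNbrs G y w = ∅ := by
        ext u
        simp only [mem_occNbrs, Finset.notMem_empty, iff_false, not_and]
        intro hwu hyu
        have huv : u ≠ v := by rintro rfl; simp [hyv] at hyu
        have : u ∈ occNbrs G x w := mem_occNbrs.2 ⟨hwu, by rwa [hyne u huv] at hyu⟩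
        rw [hw2, Finset.mem_singleton] at this
        exact huv this
      simp [hm, tagWeight, hempty, hw1]
    · exact hpos
    · have hm : moveTag G x y a = a := by simp [moveTag, hyne a (Ne.symm hva), hxa]
      obtain ⟨w, hw1, hw2⟩ := hP
      rw [hw1, Finset.mem_singleton] at hvN
      subst hvN
      have hempty : occNbrs G y a = ∅ := by
        ext u
        simp only [mem_occNbrs, Finset.notMem_empty, iff_false, not_and]
        intro hau hyu
        have huv : u ≠ v := by rintro rfl; simp [hyv] at hyu
        have : u ∈ occNbrs G x a := mem_occNbrs.2 ⟨hau, by rwa [hyne u huv] at hyu⟩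
        rw [hw1, Finset.mem_singleton] at this
        exact huv this
      simp [hm, tagWeight, hempty]
    · have hm : moveTag G x y a = a := by simp [moveTag, hyne a (Ne.symm hva), hxa]
      have h1 : occNbrs G y a = (occNbrs G x a).erase v := by
        ext u
        simp only [mem_occNbrs, Finset.mem_erase]
        by_cases huv : u = v
        · simp [huv, hyv]
        · simp [huv, hyne u huv]
      have h2 := pow_card_mul_pointMass_le_tagWeight (G := G) hη1 y a s
      rw [hm]
      rwa [h1, Finset.card_erase_of_mem hvN] at h2
    · have hm : moveTag G x y a = a := by simp [moveTag, hyne a (Ne.symm hva), hxa]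
      have hav : ¬ G.Adj a v := fun h => hvN (mem_occNbrs.2 ⟨h, hxv'⟩)
      have h1 := hsame a hav
      rw [hm]
      by_cases hN : occNbrs G x a = ∅
      · simp [tagWeight, h1, hN]
      · by_cases hP' : IsPair G x a
        · obtain ⟨w, hw1, hw2⟩ := id hP'
          have hwv : ¬ G.Adj w v := fun h => hva (by
            have : v ∈ occNbrs G x w := mem_occNbrs.2 ⟨h, hxv'⟩
            simpa [hw2] using this)
          have hPy : IsPair G y a := ⟨w, by rw [h1, hw1], by rw [hsame w hwv, hw2]⟩
          simp [tagWeight, h1, hPy, hP']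
        · rw [tagWeight, if_neg hN, if_neg hP', ← h1]
          exact pow_card_mul_pointMass_le_tagWeight hη1 y a s

theorem jumpWeight_eq_tagWeight {V : Type*} [Fintype V] {G : SimpleGraph V} {η : ℝ}
    {x : V → Bool} {a v : V} {b : Bool} {C : Set V} (haC : a ∈ C)
    (hC : ∀ u ∈ C, ∀ w, G.Adj u w → x w = true → w ∈ C)
    (h0 : b = false → v ∉ C) (h1 : b = true → x v = false → ∀ u ∈ C, ¬ G.Adj u v) :
    jumpWeight G η x a v b = tagWeight G η x a := by
  funext s
  by_cases hxv : x v = b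
  · simp [jumpWeight, hxv]
  cases b with
  | true =>
    have h1 := h1 rfl (by simpa using hxv)
    have hP : ¬ (IsPair G x a ∧ ∃ w ∈ occNbrs G x a, G.Adj w v) := by
      rintro ⟨-, w, hw, hwv⟩
      rw [mem_occNbrs] at hw
      exact h1 w (hC a haC w hw.1 hw.2) hwv
    simp only [jumpWeight, hxv, if_false, if_true, h1 a haC, hP, ite_self]
  | false =>
    have h0 := h0 rfl
    have hva : v ≠ a := by rintro rfl; exact h0 haC
    have hvN : v ∉ occNbrs G x a := by
      intro h
      rw [mem_occNbrs] at h
      exact h0 (hC a haC v h.1 h.2)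
    simp only [jumpWeight, hxv, if_false, hva, hvN, Bool.false_eq_true, ite_self]

theorem sum_pointMass {V : Type*} [Fintype V] (a : V) : ∑ s, pointMass a s = 1 := by
  simp [pointMass]

theorem sum_tagWeight_le_one {V : Type*} [Fintype V] {G : SimpleGraph V} {η : ℝ}
    (hη0 : 0 ≤ η) (x : V → Bool) (a : V) : ∑ s, tagWeight G η x a s ≤ 1 := by
  unfold tagWeight
  split_ifs with hN hP
  · exact (sum_pointMass a).le
  · obtain ⟨w, hw, -⟩ := hP
    simp only [hw, Finset.sum_singleton, ← Finset.mul_sum, Finset.sum_add_distrib, sum_pointMass]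
    linarith
  · rw [← Finset.mul_sum, sum_pointMass, mul_one]
    exact pow_le_one₀ (by norm_num) (by norm_num)

theorem sum_jumpWeight_le_one {V : Type*} [Fintype V] {G : SimpleGraph V} {η : ℝ}
    (hη0 : 0 ≤ η) (x : V → Bool) (a v : V) (b : Bool) :
    ∑ s, jumpWeight G η x a v b s ≤ 1 := by
  have ht := sum_tagWeight_le_one (G := G) hη0 x a
  unfold jumpWeight
  split_ifs with _ _ _ _ _ _ _ hP _ hP
  all_goals first | exact ht | (simp; done) | exact (sum_pointMass a).le | skip
  · simp only [← Finset.mul_sum, Finset.sum_add_distrib, sum_pointMass]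
    linarith
  · obtain ⟨w, hw, -⟩ := hP
    simp [hw, sum_pointMass]
  · rw [← Finset.mul_sum, sum_pointMass, mul_one]
    exact pow_le_one₀ (by norm_num) (by norm_num)

/-- `C j` (for `j` with first coordinate in `I`) are disjoint unions of components of occupied
vertices of `x`, and `tag j` is a vertex of `C j`. -/
structure IsTagging {V : Type*} (G : SimpleGraph V) (x : V → Bool) (I : Finset ℕ)
    (tag : ℕ × Bool → V) (C : ℕ × Bool → Set V) : Prop where
  tag_mem : ∀ j : ℕ × Bool, j.1 ∈ I → tag j ∈ C j
  occupied : ∀ j : ℕ × Bool, j.1 ∈ I → ∀ u ∈ C j, x u = true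
  closed : ∀ j : ℕ × Bool, j.1 ∈ I → ∀ u ∈ C j, ∀ w, G.Adj u w → x w = true → w ∈ C j
  disjoint : ∀ j l : ℕ × Bool, j.1 ∈ I → l.1 ∈ I → ∀ u, u ∈ C j → u ∈ C l → j = l

theorem IsTagging.update {V : Type*} [Fintype V] {G : SimpleGraph V} {x : V → Bool}
    {I I' : Finset ℕ} {tag : ℕ × Bool → V} {C : ℕ × Bool → Set V} (h : IsTagging G x I tag C)
    (hI : I' ⊆ I) {v : V} (hact : ∃ u, G.Adj u v ∧ x u = true) (b : Bool)
    (hm : b = true → x v = false → ∀ j : ℕ × Bool, j.1 ∈ I' → (∃ u ∈ C j, G.Adj u v) →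
      ∀ w, G.Adj w v → x w = true → w ∈ C j) :
    IsTagging G (Function.update x v b) I'
      (fun j => moveTag G x (Function.update x v b) (tag j))
      (fun j => {u | Function.update x v b u = true ∧ (u ∈ C j ∨ ∃ w ∈ C j, G.Adj w u)}) := by
  set y := Function.update x v b with hy
  have hyne : ∀ w, w ≠ v → y w = x w := fun w hw => Function.update_of_ne hw _ _
  have hyv : y v = b := Function.update_self v b x
  have hold : ∀ j : ℕ × Bool, j.1 ∈ I' → ∀ u, y u = true →
      (u ∈ C j ∨ ∃ w ∈ C j, G.Adj w u) →
      u ∈ C j ∨ (u = v ∧ b = true ∧ x v = false ∧ ∃ w ∈ C j, G.Adj w v) := by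
    rintro j hj u hyu (hu | ⟨w, hw, hwu⟩)
    · exact Or.inl hu
    · by_cases huv : u = v
      · subst huv
        cases hxu : x u with
        | true => exact Or.inl (h.closed j (hI hj) w hw u hwu hxu)
        | false => exact Or.inr ⟨rfl, by rw [← hyv, hyu], rfl, w, hw, hwu⟩
      · rw [hyne u huv] at hyu
        exact Or.inl (h.closed j (hI hj) w hw u hwu hyu)
  refine ⟨?_, ?_, ?_, ?_⟩
  · intro j hj
    have htj := h.tag_mem j (hI hj)
    by_cases hya : y (tag j) = true
    · have : moveTag G x y (tag j) = tag j := by simp [moveTag, hya]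
      simp only [this]
      exact ⟨hya, Or.inl htj⟩
    · have hav : tag j = v := by
        by_contra hne
        rw [hyne _ hne] at hya
        exact hya (h.occupied j (hI hj) _ htj)
      have hne : (occNbrs G x (tag j)).Nonempty := by
        obtain ⟨u, hu, hxu⟩ := hact
        exact ⟨u, mem_occNbrs.2 ⟨by rw [hav]; exact hu.symm, hxu⟩⟩
      have : moveTag G x y (tag j) = hne.choose := by simp [moveTag, hya, hne]
      simp only [this]
      have hc := mem_occNbrs.1 hne.choose_spec
      refine ⟨?_, Or.inr ⟨tag j, htj, hc.1⟩⟩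
      rw [hyne _ (by rw [← hav]; exact hc.1.ne')]
      exact hc.2
  · intro j _ u hu
    exact hu.1
  · rintro j hj u ⟨hyu, hu⟩ w huw hyw
    refine ⟨hyw, ?_⟩
    rcases hold j hj u hyu hu with hu | ⟨rfl, hb, hxu, hex⟩
    · exact Or.inr ⟨u, hu, huw⟩
    · left
      refine hm hb hxu j hj hex w huw.symm ?_
      rwa [hyne w huw.ne'] at hyw
  · rintro j l hj hl u ⟨hyu, huj⟩ ⟨-, hul⟩
    rcases hold j hj u hyu huj with huj | ⟨rfl, hb, hxu, w, hw, hwu⟩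
    · rcases hold l hl u hyu hul with hul | ⟨rfl, -, hxu, -⟩
      · exact h.disjoint j l (hI hj) (hI hl) u huj hul
      · rw [h.occupied j (hI hj) u huj] at hxu
        simp at hxu
    · rcases hold l hl u hyu hul with hul | ⟨-, -, -, hex⟩
      · rw [h.occupied l (hI hl) u hul] at hxu
        simp at hxu
      · exact h.disjoint j l (hI hj) (hI hl) w hw
          (hm hb hxu l hl hex w hwu (h.occupied j (hI hj) w hw))

/-- The bilinear form with kernel `f`. -/
def pairing {V : Type*} [Fintype V] (f : V → V → ℝ) (W W' : V → ℝ) : ℝ :=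
  ∑ s, W s * ∑ t, W' t * f s t

section Pairing

variable {V : Type*} [Fintype V] {f : V → V → ℝ} {W W' U U' : V → ℝ}

theorem pairing_comm (hfs : ∀ s t, f s t = f t s) : pairing f W W' = pairing f W' W := by
  simp only [pairing, Finset.mul_sum]
  rw [Finset.sum_comm]
  refine Finset.sum_congr rfl fun s _ => Finset.sum_congr rfl fun t _ => ?_
  rw [hfs]; ring

theorem pairing_mono (hf : ∀ s t, 0 ≤ f s t) (hW : ∀ s, 0 ≤ W s) (hW' : ∀ s, 0 ≤ W' s)
    (hU : ∀ s, W s ≤ U s) (hU' : ∀ s, W' s ≤ U' s) : pairing f W W' ≤ pairing f U U' := by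
  refine Finset.sum_le_sum fun s _ => mul_le_mul (hU s)
    (Finset.sum_le_sum fun t _ => mul_le_mul_of_nonneg_right (hU' t) (hf s t))
    (Finset.sum_nonneg fun t _ => mul_nonneg (hW' t) (hf s t)) ((hW s).trans (hU s))

theorem pairing_nonneg (hf : ∀ s t, 0 ≤ f s t) (hW : ∀ s, 0 ≤ W s) (hW' : ∀ s, 0 ≤ W' s) :
    0 ≤ pairing f W W' :=
  Finset.sum_nonneg fun s _ => mul_nonneg (hW s)
    (Finset.sum_nonneg fun t _ => mul_nonneg (hW' t) (hf s t))

theorem pairing_le_one (hf1 : ∀ s t, f s t ≤ 1) (hW : ∀ s, 0 ≤ W s)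
    (hW' : ∀ s, 0 ≤ W' s) (h1 : ∑ s, W s ≤ 1) (h1' : ∑ s, W' s ≤ 1) : pairing f W W' ≤ 1 := by
  have h2 : ∀ s, ∑ t, W' t * f s t ≤ 1 := fun s =>
    (Finset.sum_le_sum fun t _ => mul_le_of_le_one_right (hW' t) (hf1 s t)).trans h1'
  exact (Finset.sum_le_sum fun s _ => mul_le_of_le_one_right (hW s) (h2 s)).trans h1

end Pairing

theorem jumpWeight_pair_eq {V : Type*} [Fintype V] {G : SimpleGraph V} {η : ℝ}
    {x : V → Bool} {a a' v : V} {b : Bool} {C C' : Set V} (ha : a ∈ C) (ha' : a' ∈ C')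
    (hC : ∀ u ∈ C, ∀ w, G.Adj u w → x w = true → w ∈ C)
    (hC' : ∀ u ∈ C', ∀ w, G.Adj u w → x w = true → w ∈ C')
    (hx' : ∀ u ∈ C', x u = true)
    (hdisj : ∀ u ∈ C, u ∉ C')
    (hm : b = true → x v = false → (∃ u ∈ C, G.Adj u v) → ∀ w, G.Adj w v → x w = true → w ∈ C) :
    jumpWeight G η x a v b = tagWeight G η x a ∨ jumpWeight G η x a' v b = tagWeight G η x a' := by
  cases b with
  | false =>
    by_cases hv : v ∈ C
    · exact Or.inr (jumpWeight_eq_tagWeight ha' hC' (fun _ => hdisj v hv) (by simp))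
    · exact Or.inl (jumpWeight_eq_tagWeight ha hC (fun _ => hv) (by simp))
  | true =>
    by_cases hex : x v = false ∧ ∃ u ∈ C, G.Adj u v
    · refine Or.inr (jumpWeight_eq_tagWeight ha' hC' (by simp) fun _ hxv u hu huv => ?_)
      exact hdisj u (hm rfl hxv hex.2 u huv (hx' u hu)) hu
    · refine Or.inl (jumpWeight_eq_tagWeight ha hC (by simp) fun _ hxv u hu huv => ?_)
      exact hex ⟨hxv, u, hu, huv⟩

section Step

variable {V : Type*} [Fintype V] {G : SimpleGraph V} {k : ℕ} {p η rate mu : ℝ} {f : V → V → ℝ}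

/-- The interaction of the two particles tagged at `a` and `a'`. -/
def pairWeight (G : SimpleGraph V) (η : ℝ) (f : V → V → ℝ) (x : V → Bool) (a a' : V) : ℝ :=
  pairing f (tagWeight G η x a) (tagWeight G η x a')

/-- A lower bound for the interaction of the particles tagged at `a` and `a'` after the label of
`v` has been set to `b`, up to its present value. -/
def pairGain (G : SimpleGraph V) (η : ℝ) (f : V → V → ℝ) (x : V → Bool) (a a' v : V)
    (b : Bool) : ℝ :=
  (pairing f (jumpWeight G η x a v b) (tagWeight G η x a') - pairWeight G η f x a a') +
    (pairing f (tagWeight G η x a) (jumpWeight G η x a' v b) - pairWeight G η f x a a')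

theorem pairWeight_nonneg (hf0 : ∀ s t, 0 ≤ f s t) (hη1 : η ≤ 1 / 2) (x : V → Bool) (a a' : V) :
    0 ≤ pairWeight G η f x a a' :=
  pairing_nonneg hf0 (tagWeight_nonneg hη1 x a) (tagWeight_nonneg hη1 x a')

theorem pairWeight_le_one (hf1 : ∀ s t, f s t ≤ 1) (hη0 : 0 ≤ η) (hη1 : η ≤ 1 / 2)
    (x : V → Bool) (a a' : V) : pairWeight G η f x a a' ≤ 1 :=
  pairing_le_one hf1 (tagWeight_nonneg hη1 x a) (tagWeight_nonneg hη1 x a')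
    (sum_tagWeight_le_one hη0 x a) (sum_tagWeight_le_one hη0 x a')

theorem pairWeight_add_pairGain_le_two (hf0 : ∀ s t, 0 ≤ f s t) (hf1 : ∀ s t, f s t ≤ 1)
    (hη0 : 0 ≤ η) (hη1 : η ≤ 1 / 2) (x : V → Bool) (a a' v : V) (b : Bool) :
    pairWeight G η f x a a' + pairGain G η f x a a' v b ≤ 2 := by
  have h1 : pairing f (jumpWeight G η x a v b) (tagWeight G η x a') ≤ 1 :=
    pairing_le_one hf1 (jumpWeight_nonneg hη1 x a v b) (tagWeight_nonneg hη1 x a')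
      (sum_jumpWeight_le_one hη0 x a v b) (sum_tagWeight_le_one hη0 x a')
  have h2 : pairing f (tagWeight G η x a) (jumpWeight G η x a' v b) ≤ 1 :=
    pairing_le_one hf1 (tagWeight_nonneg hη1 x a) (jumpWeight_nonneg hη1 x a' v b)
      (sum_tagWeight_le_one hη0 x a) (sum_jumpWeight_le_one hη0 x a' v b)
  have h3 := pairWeight_nonneg (G := G) hf0 hη1 x a a'
  unfold pairGain
  linarith

theorem pairWeight_add_pairGain_le (hf0 : ∀ s t, 0 ≤ f s t) (hη1 : η ≤ 1 / 2)
    {x : V → Bool} {a a' v : V} {b : Bool} (hxa : x a = true) (hxa' : x a' = true)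
    (hiso : occNbrs G x a = ∅ → G.Adj a v → ∀ u, G.Adj u v → x u = true → u = a)
    (hiso' : occNbrs G x a' = ∅ → G.Adj a' v → ∀ u, G.Adj u v → x u = true → u = a')
    (hor : jumpWeight G η x a v b = tagWeight G η x a ∨
      jumpWeight G η x a' v b = tagWeight G η x a') :
    pairWeight G η f x a a' + pairGain G η f x a a' v b ≤
      pairWeight G η f (Function.update x v b) (moveTag G x (Function.update x v b) a)
        (moveTag G x (Function.update x v b) a') := by
  have h : pairing f (jumpWeight G η x a v b) (jumpWeight G η x a' v b) ≤
      pairWeight G η f (Function.update x v b) (moveTag G x (Function.update x v b) a)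
        (moveTag G x (Function.update x v b) a') :=
    pairing_mono hf0 (jumpWeight_nonneg hη1 x a v b) (jumpWeight_nonneg hη1 x a' v b)
      (jumpWeight_le_tagWeight hη1 hxa b hiso) (jumpWeight_le_tagWeight hη1 hxa' b hiso')
  rcases hor with hor | hor
  · rw [hor] at h
    simp only [pairGain, hor, pairWeight] at h ⊢
    linarith
  · rw [hor] at h
    simp only [pairGain, hor, pairWeight] at h ⊢
    linarith

theorem IsTagging.exists_step (hk : ∀ a, (Finset.univ.filter (G.Adj a)).card ≤ k)
    (hf0 : ∀ s t, 0 ≤ f s t) (hf1 : ∀ s t, f s t ≤ 1) (hη0 : 0 ≤ η) (hη1 : η ≤ 1 / 2)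
    {x : V → Bool} {I : Finset ℕ} {tag : ℕ × Bool → V} {C : ℕ × Bool → Set V}
    (h : IsTagging G x I tag C) {v : V} (hact : ∃ u, G.Adj u v ∧ x u = true) (b : Bool) :
    ∃ I' ⊆ I, ∃ tag' C', IsTagging G (Function.update x v b) I' tag' C' ∧
      ∑ i ∈ I, (pairWeight G η f x (tag (i, false)) (tag (i, true)) +
          pairGain G η f x (tag (i, false)) (tag (i, true)) v b) ≤
        ∑ i ∈ I', pairWeight G η f (Function.update x v b) (tag' (i, false)) (tag' (i, true)) +
          2 * k * (if numComponents G (Function.update x v b) < numComponents G x then 1 else 0) := by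
  have hxt : ∀ j : ℕ × Bool, j.1 ∈ I → x (tag j) = true :=
    fun j hj => h.occupied j hj _ (h.tag_mem j hj)
  have hor : ∀ i ∈ I, (b = true → x v = false → (∃ u ∈ C (i, false), G.Adj u v) →
        ∀ w, G.Adj w v → x w = true → w ∈ C (i, false)) →
      (jumpWeight G η x (tag (i, false)) v b = tagWeight G η x (tag (i, false)) ∨
        jumpWeight G η x (tag (i, true)) v b = tagWeight G η x (tag (i, true))) := by
    intro i hi hm
    refine jumpWeight_pair_eq (h.tag_mem (i, false) hi) (h.tag_mem (i, true) hi)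
      (h.closed (i, false) hi) (h.closed (i, true) hi) (h.occupied (i, true) hi) ?_ hm
    intro u hu hu'
    have := h.disjoint (i, false) (i, true) hi hi u hu hu'
    simp at this
  by_cases hcol : (b = true ∧ x v = false) ∧
      numComponents G (Function.update x v b) < numComponents G x
  · obtain ⟨⟨rfl, hxv⟩, hlt⟩ := hcol
    set far : ℕ → Prop := fun i => ∀ s : Bool, ∀ u ∈ C (i, s), ¬ G.Adj u v with hfar
    have hfar_not : ∀ j : ℕ × Bool, j.1 ∈ I.filter far → ¬ ∃ u ∈ C j, G.Adj u v := by
      rintro ⟨i, s⟩ hj ⟨u, hu, huv⟩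
      exact (Finset.mem_filter.1 hj).2 s u hu huv
    refine ⟨I.filter far, Finset.filter_subset _ _, _, _,
      h.update (Finset.filter_subset _ _) hact true
        (fun _ _ j hj hex => absurd hex (hfar_not j hj)), ?_⟩
    rw [← Finset.sum_filter_add_sum_filter_not I far]
    refine add_le_add (Finset.sum_le_sum fun i hi => ?_) ?_
    · have hiI := (Finset.mem_filter.1 hi).1
      refine pairWeight_add_pairGain_le hf0 hη1 (hxt _ hiI) (hxt _ hiI) ?_ ?_
        (hor i hiI fun _ _ hex => absurd hex (hfar_not (i, false) hi))
      · exact fun _ hav => absurd ⟨_, h.tag_mem (i, false) hiI, hav⟩ (hfar_not (i, false) hi)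
      · exact fun _ hav => absurd ⟨_, h.tag_mem (i, true) hiI, hav⟩ (hfar_not (i, true) hi)
    · rw [if_pos hlt, mul_one]
      have hcard : (I.filter fun i => ¬ far i).card ≤ k := by
        refine le_trans ?_ (hk v)
        have hex : ∀ i ∈ I.filter (fun i => ¬ far i), ∃ u, G.Adj u v ∧ ∃ s, u ∈ C (i, s) := by
          intro i hi
          have := (Finset.mem_filter.1 hi).2
          simp only [hfar, not_forall, not_not] at this
          obtain ⟨s, u, hu, huv⟩ := this
          exact ⟨u, huv, s, hu⟩
        have : Nonempty V := ⟨v⟩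
        choose! nb hnb hnbC using hex
        refine Finset.card_le_card_of_injOn nb (fun i hi => ?_) ?_
        · simpa using (hnb i hi).symm
        · intro i hi l hl hil
          obtain ⟨s, hs⟩ := hnbC i hi
          obtain ⟨t, ht⟩ := hnbC l hl
          have hi' := (Finset.mem_filter.1 hi).1
          have hl' := (Finset.mem_filter.1 hl).1
          rw [← hil] at ht
          exact congrArg Prod.fst (h.disjoint (i, s) (l, t) hi' hl' _ hs ht)
      calc ∑ i ∈ I.filter (fun i => ¬ far i), (pairWeight G η f x (tag (i, false)) (tag (i, true)) +
              pairGain G η f x (tag (i, false)) (tag (i, true)) v true)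
          ≤ ∑ i ∈ I.filter (fun i => ¬ far i), (2 : ℝ) :=
            Finset.sum_le_sum fun i _ => pairWeight_add_pairGain_le_two hf0 hf1 hη0 hη1 _ _ _ _ _
        _ = 2 * ((I.filter fun i => ¬ far i).card : ℝ) := by
            rw [Finset.sum_const, nsmul_eq_mul, mul_comm]
        _ ≤ 2 * k := by
            have : ((I.filter fun i => ¬ far i).card : ℝ) ≤ k := by exact_mod_cast hcard
            linarith
  · have hncol : ∀ D : Set V, (∀ u ∈ D, ∀ w, G.Adj u w → x w = true → w ∈ D) →
        b = true → x v = false → ∀ u ∈ D, x u = true → G.Adj u v →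
        ∀ w, G.Adj w v → x w = true → w ∈ D := by
      rintro D hD rfl hxv u hu hxu huv w hwv hxw
      by_contra hw
      exact hcol ⟨⟨rfl, hxv⟩, numComponents_update_lt G x D hD hxv hu huv hxu hw hwv hxw⟩
    have hm : ∀ j : ℕ × Bool, j.1 ∈ I → b = true → x v = false → (∃ u ∈ C j, G.Adj u v) →
        ∀ w, G.Adj w v → x w = true → w ∈ C j := by
      rintro j hj hb hxv ⟨u, hu, huv⟩
      exact hncol (C j) (h.closed j hj) hb hxv u hu (h.occupied j hj u hu) huv
    have hiso : b = true → x v = false → ∀ a, x a = true → occNbrs G x a = ∅ → G.Adj a v →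
        ∀ u, G.Adj u v → x u = true → u = a := by
      intro hb hxv a hxa hN hav
      refine hncol {a} ?_ hb hxv a rfl hxa hav
      rintro u rfl w huw hxw
      have : w ∈ occNbrs G x u := mem_occNbrs.2 ⟨huw, hxw⟩
      simp [hN] at this
    have hnn : (0 : ℝ) ≤ 2 * k * (if numComponents G (Function.update x v b) < numComponents G x
        then 1 else 0) := by positivity
    by_cases hb : b = true ∧ x v = false
    · refine ⟨I, subset_rfl, _, _, h.update subset_rfl hact b
        (fun hb hxv j hj => hm j hj hb hxv), ?_⟩
      refine le_add_of_le_of_nonneg (Finset.sum_le_sum fun i hi => ?_) hnn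
      exact pairWeight_add_pairGain_le hf0 hη1 (hxt _ hi) (hxt _ hi)
        (hiso hb.1 hb.2 _ (hxt _ hi)) (hiso hb.1 hb.2 _ (hxt _ hi))
        (hor i hi (hm (i, false) hi))
    · refine ⟨I, subset_rfl, _, _, h.update subset_rfl hact b
        (fun hb hxv j hj => hm j hj hb hxv), ?_⟩
      refine le_add_of_le_of_nonneg (Finset.sum_le_sum fun i hi => ?_) hnn
      by_cases hxv : x v = b
      · have hu : Function.update x v b = x := by rw [← hxv]; simp
        have hm0 : ∀ j : ℕ × Bool, j.1 ∈ I → moveTag G x x (tag j) = tag j := fun j hj => by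
          simp [moveTag, hxt j hj]
        have hj : ∀ a, jumpWeight G η x a v b = tagWeight G η x a := fun a => by
          funext s; simp [jumpWeight, hxv]
        rw [hu]
        simp only [hm0 (i, false) hi, hm0 (i, true) hi, pairGain, hj, pairWeight]
        linarith
      · have hxv' : x v = true := by
          cases hx : x v with
          | true => rfl
          | false =>
            refine absurd ⟨?_, hx⟩ hb
            rw [hx] at hxv
            cases b with
            | true => rfl
            | false => exact absurd rfl hxv
        have hN : ∀ a, occNbrs G x a = ∅ → G.Adj a v → ∀ u, G.Adj u v → x u = true → u = a := by
          intro a hN hav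
          have : v ∈ occNbrs G x a := mem_occNbrs.2 ⟨hav, hxv'⟩
          simp [hN] at this
        exact pairWeight_add_pairGain_le hf0 hη1 (hxt _ hi) (hxt _ hi) (hN _) (hN _)
          (hor i hi (hm (i, false) hi))

end Step

theorem tagWeight_eq_zero {V : Type*} [Fintype V] {G : SimpleGraph V} {η : ℝ} {x : V → Bool}
    {a t : V} (hta : t ≠ a) (ht : ¬ (G.Adj a t ∧ x t = true)) : tagWeight G η x a t = 0 := by
  have h1 : ∀ w ∈ occNbrs G x a, pointMass w t = 0 := by
    intro w hw
    rw [mem_occNbrs] at hw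
    exact if_neg (by rintro rfl; exact ht hw)
  have h2 : pointMass a t = 0 := if_neg hta
  simp [tagWeight, h2, Finset.sum_eq_zero h1]

section Drift

variable {V : Type*} [Fintype V] {G : SimpleGraph V} {k : ℕ} {p η rate mu : ℝ} {f : V → V → ℝ}

theorem drift_pairing (hk : ∀ a, (Finset.univ.filter (G.Adj a)).card ≤ k)
    (hp0 : 0 ≤ p) (hp1 : p ≤ 1 / 2) (hη0 : 0 ≤ η) (hη1 : η ≤ 1 / 2)
    (h1 : rate ≤ η - 2 * k * p) (h2 : rate ≤ 1 - k * p)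
    (h3 : rate ≤ p * ((1 - η) / 2 * mu - η * k)) (hf0 : ∀ s t, 0 ≤ f s t)
    (hsub : ∀ a t, a ≠ t → mu * f a t ≤ ∑ v ∈ Finset.univ.filter (G.Adj a), (f v t - f a t))
    {x : V → Bool} {a a' : V} (hxa : x a = true) (hne : a ≠ a') (hadj : ¬ G.Adj a' a) :
    rate * pairWeight G η f x a a' ≤
      ∑ v, if ∃ u, G.Adj u v ∧ x u = true then
        p * (pairing f (jumpWeight G η x a v true) (tagWeight G η x a') - pairWeight G η f x a a')
        + (1 - p) * (pairing f (jumpWeight G η x a v false) (tagWeight G η x a') -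
          pairWeight G η f x a a')
        else 0 := by
  refine drift_tagWeight hk hp0 hp1 hη0 hη1 h1 h2 h3 hxa
    (g := fun s => ∑ t, tagWeight G η x a' t * f s t)
    (fun s => Finset.sum_nonneg fun t _ => mul_nonneg (tagWeight_nonneg hη1 x a' t) (hf0 s t)) ?_
  simp only [← Finset.sum_sub_distrib, ← mul_sub]
  rw [Finset.sum_comm, Finset.mul_sum]
  refine Finset.sum_le_sum fun t _ => ?_
  rw [← Finset.mul_sum]
  by_cases hat : a = t
  · subst hat
    rw [tagWeight_eq_zero hne fun h => hadj h.1]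
    simp
  · have := mul_le_mul_of_nonneg_left (hsub a t hat) (tagWeight_nonneg (G := G) hη1 x a' t)
    linarith

theorem drift_pairGain (hk : ∀ a, (Finset.univ.filter (G.Adj a)).card ≤ k)
    (hp0 : 0 ≤ p) (hp1 : p ≤ 1 / 2) (hη0 : 0 ≤ η) (hη1 : η ≤ 1 / 2)
    (h1 : rate ≤ η - 2 * k * p) (h2 : rate ≤ 1 - k * p)
    (h3 : rate ≤ p * ((1 - η) / 2 * mu - η * k)) (hf0 : ∀ s t, 0 ≤ f s t)
    (hfs : ∀ s t, f s t = f t s)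
    (hsub : ∀ a t, a ≠ t → mu * f a t ≤ ∑ v ∈ Finset.univ.filter (G.Adj a), (f v t - f a t))
    {x : V → Bool} {a a' : V} (hxa : x a = true) (hxa' : x a' = true) (hne : a ≠ a')
    (hadj : ¬ G.Adj a' a) :
    2 * rate * pairWeight G η f x a a' ≤
      ∑ v, if ∃ u, G.Adj u v ∧ x u = true then
        p * pairGain G η f x a a' v true + (1 - p) * pairGain G η f x a a' v false else 0 := by
  have e1 := drift_pairing hk hp0 hp1 hη0 hη1 h1 h2 h3 hf0 hsub hxa hne hadj
  have e2 := drift_pairing hk hp0 hp1 hη0 hη1 h1 h2 h3 hf0 hsub hxa' hne.symm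
    fun h => hadj h.symm
  have e3 := add_le_add e1 e2
  rw [← Finset.sum_add_distrib] at e3
  have hc : pairWeight G η f x a' a = pairWeight G η f x a a' := pairing_comm hfs
  rw [hc] at e3
  refine le_trans (by linarith) (e3.trans (le_of_eq (Finset.sum_congr rfl fun v _ => ?_)))
  split_ifs
  · rw [pairing_comm hfs (W := jumpWeight G η x a' v true),
      pairing_comm hfs (W := jumpWeight G η x a' v false)]
    simp only [pairGain]
    ring
  · simp

/-- If the pairwise interaction of tagged particles grows exponentially at rate `h`, then the
expected number of collisions controls the initial interaction. -/
theorem sum_pairWeight_le_expDrops [Nonempty V]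
    (hk : ∀ a, (Finset.univ.filter (G.Adj a)).card ≤ k)
    (hp0 : 0 ≤ p) (hp1 : p ≤ 1 / 2) (hη0 : 0 ≤ η) (hη1 : η ≤ 1 / 2)
    (h1 : rate ≤ η - 2 * k * p) (h2 : rate ≤ 1 - k * p)
    (h3 : rate ≤ p * ((1 - η) / 2 * mu - η * k)) (hf0 : ∀ s t, 0 ≤ f s t)
    (hf1 : ∀ s t, f s t ≤ 1) (hfs : ∀ s t, f s t = f t s)
    (hsub : ∀ a t, a ≠ t → mu * f a t ≤ ∑ v ∈ Finset.univ.filter (G.Adj a), (f v t - f a t))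
    {h : ℝ} (hh0 : 0 ≤ h) (hh : Fintype.card V * h ≤ 2 * rate) (m : ℕ) (T : ℕ) :
    ∀ (x : V → Bool) (I : Finset ℕ) (tag : ℕ × Bool → V) (C : ℕ × Bool → Set V),
      IsTagging G x I tag C → I.card ≤ m →
      ∑ i ∈ I, pairWeight G η f x (tag (i, false)) (tag (i, true)) - m * ((1 + h)⁻¹) ^ T ≤
        2 * k * expDrops (kcipKernel G p) (numComponents G) x T := by
  induction T with
  | zero =>
    intro x I tag C _ hI
    rw [expDrops_zero]
    have : ∑ i ∈ I, pairWeight G η f x (tag (i, false)) (tag (i, true)) ≤ ∑ i ∈ I, (1 : ℝ) :=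
      Finset.sum_le_sum fun i _ => pairWeight_le_one hf1 hη0 hη1 _ _ _
    have hI' : (I.card : ℝ) ≤ m := by exact_mod_cast hI
    simp only [Finset.sum_const, nsmul_eq_mul, mul_one] at this
    simp only [pow_zero, mul_one, mul_zero]
    linarith
  | succ T ih =>
    intro x I tag C hT hI
    set θ := (1 + h)⁻¹ with hθ
    set Ψ := ∑ i ∈ I, pairWeight G η f x (tag (i, false)) (tag (i, true)) with hΨ
    have hxt : ∀ j : ℕ × Bool, j.1 ∈ I → x (tag j) = true :=
      fun j hj => hT.occupied j hj _ (hT.tag_mem j hj)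
    have hE0 := expDrops_nonneg (kcipKernel G p)
      (kcipKernel_nonneg G hp0 (by linarith)) (numComponents G) x (T + 1)
    by_cases hsmall : Ψ - m * θ ^ (T + 1) ≤ 0
    · exact hsmall.trans (by positivity)
    push Not at hsmall
    rw [expDrops_succ _ (sum_kcipKernel G p), sum_kcipKernel_mul]
    set E := fun y => (if numComponents G y < numComponents G x then (1 : ℝ) else 0) +
      expDrops (kcipKernel G p) (numComponents G) y T with hE
    have hstay : Ψ - m * θ ^ T ≤ 2 * k * E x := by
      have := ih x I tag C hT hI
      simpa [hE] using this
    have hupd : ∀ v, (∃ u, G.Adj u v ∧ x u = true) → ∀ b,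
        Ψ - m * θ ^ T + ∑ i ∈ I, pairGain G η f x (tag (i, false)) (tag (i, true)) v b ≤
          2 * k * E (Function.update x v b) := by
      intro v hact b
      obtain ⟨I', hI', tag', C', hT', hle⟩ := hT.exists_step (f := f) hk hf0 hf1 hη0 hη1 hact b
      have := ih _ I' tag' C' hT' ((Finset.card_le_card hI').trans hI)
      rw [Finset.sum_add_distrib] at hle
      simp only [hE]
      linarith
    set n : ℝ := (Fintype.card V : ℝ) with hn
    have hn0 : 0 < n := by
      rw [hn]; exact_mod_cast Fintype.card_pos
    have hdrift : 2 * rate * Ψ ≤ ∑ v, if ∃ u, G.Adj u v ∧ x u = true then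
        p * (∑ i ∈ I, pairGain G η f x (tag (i, false)) (tag (i, true)) v true) +
          (1 - p) * (∑ i ∈ I, pairGain G η f x (tag (i, false)) (tag (i, true)) v false)
        else 0 := by
      have : ∀ i ∈ I, 2 * rate * pairWeight G η f x (tag (i, false)) (tag (i, true)) ≤ _ :=
        fun i hi => drift_pairGain hk hp0 hp1 hη0 hη1 h1 h2 h3 hf0 hfs hsub
          (hxt (i, false) hi) (hxt (i, true) hi)
          (fun he => by
            have := hT.disjoint (i, false) (i, true) hi hi _ (hT.tag_mem _ hi)
              (by rw [he]; exact hT.tag_mem _ hi)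
            simp at this)
          (fun hadj => by
            have := hT.disjoint (i, false) (i, true) hi hi _ (hT.tag_mem _ hi)
              (hT.closed (i, true) hi _ (hT.tag_mem _ hi) _ hadj (hxt (i, false) hi))
            simp at this)
      have hs := Finset.sum_le_sum this
      rw [← Finset.mul_sum, Finset.sum_comm] at hs
      refine hs.trans (le_of_eq (Finset.sum_congr rfl fun v _ => ?_))
      split_ifs
      · rw [Finset.sum_add_distrib, Finset.mul_sum, Finset.mul_sum]
      · simp
    have hΨ0 : 0 ≤ Ψ := Finset.sum_nonneg fun i _ => pairWeight_nonneg hf0 hη1 _ _ _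
    have hsum : n * (Ψ - m * θ ^ T) + 2 * rate * Ψ ≤
        2 * k * ∑ v, if ∃ u, G.Adj u v ∧ x u = true then
          p * E (Function.update x v true) + (1 - p) * E (Function.update x v false) else E x := by
      have hconst : n * (Ψ - m * θ ^ T) = ∑ _v : V, (Ψ - m * θ ^ T) := by
        rw [Finset.sum_const, nsmul_eq_mul, Finset.card_univ]
      rw [hconst, Finset.mul_sum _ _ (2 * (k : ℝ))]
      refine (add_le_add_right hdrift _).trans ?_
      rw [← Finset.sum_add_distrib]
      refine Finset.sum_le_sum fun v _ => ?_
      split_ifs with hact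
      · have e1 := mul_le_mul_of_nonneg_left (hupd v hact true) hp0
        have e2 := mul_le_mul_of_nonneg_left (hupd v hact false) (by linarith : 0 ≤ 1 - p)
        linarith
      · linarith
    have hθ0 : θ ^ T = (1 + h) * θ ^ (T + 1) := by
      rw [pow_succ, hθ]
      field_simp
    have h4 : n * (Ψ - m * θ ^ T) + n * h * Ψ ≤ n * (Ψ - m * θ ^ T) + 2 * rate * Ψ := by
      have := mul_le_mul_of_nonneg_right hh hΨ0
      linarith
    have h5 : n * (Ψ - m * θ ^ (T + 1)) ≤ n * (Ψ - m * θ ^ T) + n * h * Ψ := by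
      rw [hθ0]
      have : 0 ≤ n * (h * (Ψ - m * θ ^ (T + 1))) := by positivity
      linarith
    have h6 := h5.trans (h4.trans hsum)
    rw [← mul_assoc, mul_comm (2 * (k : ℝ)) n⁻¹, mul_assoc, ← div_eq_inv_mul, le_div_iff₀ hn0]
    linarith

end Drift

theorem exists_isTagging {V : Type*} [Fintype V] [Nonempty V] (G : SimpleGraph V)
    (x : V → Bool) :
    ∃ tag C, IsTagging G x (Finset.range (numComponents G x / 2)) tag C := by
  set S : Set V := {v | x v = true} with hS
  let e : (G.induce S).ConnectedComponent ≃ Fin (numComponents G x) := Finite.equivFin _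
  let idx : ℕ × Bool → ℕ := fun j => 2 * j.1 + j.2.toNat
  have hidx : Function.Injective idx := by
    rintro ⟨i, s⟩ ⟨l, t⟩ h
    have h : 2 * i + s.toNat = 2 * l + t.toNat := h
    cases s <;> cases t <;> simp at h ⊢ <;> omega
  have hlt : ∀ j : ℕ × Bool, j.1 ∈ Finset.range (numComponents G x / 2) →
      idx j < numComponents G x := by
    rintro ⟨i, s⟩ hi
    have hi : i < numComponents G x / 2 := Finset.mem_range.1 hi
    have := Bool.toNat_le s
    change 2 * i + s.toNat < _
    omega
  let C : ℕ × Bool → Set V := fun j =>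
    {u | ∃ hu : u ∈ S, (e ((G.induce S).connectedComponentMk ⟨u, hu⟩) : ℕ) = idx j}
  have hne : ∀ j : ℕ × Bool, j.1 ∈ Finset.range (numComponents G x / 2) → ∃ u, u ∈ C j := by
    intro j hj
    obtain ⟨u, hu⟩ := (e.symm ⟨idx j, hlt j hj⟩).exists_rep
    refine ⟨u.1, u.2, ?_⟩
    change ((e (Quot.mk _ u) : Fin _) : ℕ) = idx j
    rw [hu, Equiv.apply_symm_apply]
  choose! tag htag using hne
  refine ⟨tag, C, htag, fun j _ u hu => hu.1, ?_, ?_⟩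
  · rintro j _ u ⟨hu, hue⟩ w huw hxw
    refine ⟨hxw, ?_⟩
    rw [← hue]
    congr 2
    refine SimpleGraph.ConnectedComponent.sound (SimpleGraph.Adj.reachable ?_)
    exact huw.symm
  · rintro j l _ _ u ⟨_, h1⟩ ⟨_, h2⟩
    exact hidx (h1.symm.trans h2)

theorem pow_mul_le_pairWeight {V : Type*} [Fintype V] {G : SimpleGraph V} {k : ℕ} {η : ℝ}
    {f : V → V → ℝ} (hk : ∀ a, (Finset.univ.filter (G.Adj a)).card ≤ k) (hη1 : η ≤ 1 / 2)
    (hf0 : ∀ s t, 0 ≤ f s t) (x : V → Bool) (a a' : V) :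
    (1 / 4) ^ (2 * k) * f a a' ≤ pairWeight G η f x a a' := by
  have hle : ∀ a s : V, (1 / 4 : ℝ) ^ k * pointMass a s ≤ tagWeight G η x a s := by
    intro a s
    refine le_trans (mul_le_mul_of_nonneg_right ?_ (pointMass_nonneg a s))
      (pow_card_mul_pointMass_le_tagWeight hη1 x a s)
    refine pow_le_pow_of_le_one (by norm_num) (by norm_num) (le_trans ?_ (hk a))
    exact Finset.card_le_card fun w hw => by simpa using (mem_occNbrs.1 hw).1
  have hnn : ∀ a s : V, 0 ≤ (1 / 4 : ℝ) ^ k * pointMass a s :=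
    fun a s => mul_nonneg (by positivity) (pointMass_nonneg a s)
  refine le_trans (le_of_eq ?_) (pairing_mono hf0 (hnn a) (hnn a') (hle a) (hle a'))
  simp only [pairing, mul_assoc, ← Finset.mul_sum, sum_pointMass_mul]
  rw [two_mul, pow_add, mul_assoc]

theorem half_numComponents_mul_le_expDrops {V : Type*} [Fintype V] [Nonempty V]
    {G : SimpleGraph V} {k : ℕ} {p η rate mu : ℝ} {f : V → V → ℝ}
    (hk : ∀ a, (Finset.univ.filter (G.Adj a)).card ≤ k)
    (hp0 : 0 ≤ p) (hp1 : p ≤ 1 / 2) (hη0 : 0 ≤ η) (hη1 : η ≤ 1 / 2)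
    (h1 : rate ≤ η - 2 * k * p) (h2 : rate ≤ 1 - k * p)
    (h3 : rate ≤ p * ((1 - η) / 2 * mu - η * k)) {δ : ℝ} (hδ : 0 ≤ δ)
    (hf0 : ∀ s t, δ ≤ f s t)
    (hf1 : ∀ s t, f s t ≤ 1) (hfs : ∀ s t, f s t = f t s)
    (hsub : ∀ a t, a ≠ t → mu * f a t ≤ ∑ v ∈ Finset.univ.filter (G.Adj a), (f v t - f a t))
    {h : ℝ} (hh0 : 0 ≤ h) (hh : Fintype.card V * h ≤ 2 * rate) (T : ℕ) (x : V → Bool) :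
    ((numComponents G x / 2 : ℕ) : ℝ) * ((1 / 4) ^ (2 * k) * δ - ((1 + h)⁻¹) ^ T) ≤
      2 * k * expDrops (kcipKernel G p) (numComponents G) x T := by
  obtain ⟨tag, C, hT⟩ := exists_isTagging G x
  have hnn : ∀ s t, 0 ≤ f s t := fun s t => hδ.trans (hf0 s t)
  refine le_trans ?_ (sum_pairWeight_le_expDrops hk hp0 hp1 hη0 hη1 h1 h2 h3 hnn hf1 hfs hsub
    hh0 hh (numComponents G x / 2) T x _ tag C hT (Finset.card_range _).le)
  rw [mul_sub]
  refine sub_le_sub_right ?_ _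
  rw [← nsmul_eq_mul]
  nth_rewrite 1 [← Finset.card_range (numComponents G x / 2)]
  refine Finset.card_nsmul_le_sum _ _ _ fun i _ => ?_
  exact (mul_le_mul_of_nonneg_left (hf0 _ _) (by positivity)).trans
    (pow_mul_le_pairWeight hk hη1 hnn x _ _)

theorem rpow_neg_ge_tangent {σ x y : ℝ} (hσ : 0 ≤ σ) (hx : 0 < x) (hy : 0 < y) :
    y ^ (-σ) - σ * y ^ (-σ - 1) * (x - y) ≤ x ^ (-σ) := by
  have hxy : 0 < x / y := div_pos hx hy
  have h1 : 1 - σ * (x / y - 1) ≤ (x / y) ^ (-σ) := by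
    rw [Real.rpow_def_of_pos hxy]
    have h2 := Real.add_one_le_exp (Real.log (x / y) * -σ)
    have h3 := mul_le_mul_of_nonneg_left (Real.log_le_sub_one_of_pos hxy) hσ
    linarith
  have h4 := mul_le_mul_of_nonneg_left h1 (Real.rpow_nonneg hy.le (-σ))
  rw [← Real.mul_rpow hy.le hxy.le, mul_div_cancel₀ x hy.ne'] at h4
  rw [Real.rpow_sub_one hy.ne']
  refine le_trans (le_of_eq ?_) h4
  field_simp

theorem two_add_le_rpow_neg_add_rpow_neg {σ y : ℝ} (hσ : 0 ≤ σ) (hy0 : 0 ≤ y) (hy1 : y < 1) :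
    2 + σ * (σ + 1) * y ^ 2 ≤ (1 + y) ^ (-σ) + (1 - y) ^ (-σ) := by
  have hd1 : ∀ (r z : ℝ), 0 ≤ z → z < 1 →
      HasDerivAt (fun z : ℝ => (1 + z) ^ (-r)) (-r * (1 + z) ^ (-r - 1)) z := by
    intro r z h0 h1
    have := ((hasDerivAt_id z).const_add 1).rpow_const (p := -r) (Or.inl (by simp; linarith))
    simpa using this
  have hd2 : ∀ (r z : ℝ), 0 ≤ z → z < 1 →
      HasDerivAt (fun z : ℝ => (1 - z) ^ (-r)) (r * (1 - z) ^ (-r - 1)) z := by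
    intro r z h0 h1
    have := ((hasDerivAt_id z).const_sub 1).rpow_const (p := -r) (Or.inl (by simp; linarith))
    simpa using this
  have key : ∀ (F F' : ℝ → ℝ), (∀ z, 0 ≤ z → z < 1 → HasDerivAt F (F' z) z) →
      (∀ z, 0 ≤ z → z < 1 → 0 ≤ F' z) → ∀ z, 0 ≤ z → z < 1 → F 0 ≤ F z := by
    intro F F' hF hF' z h0 h1
    refine monotoneOn_of_deriv_nonneg (convex_Icc 0 z) ?_ ?_ ?_ ⟨le_rfl, h0⟩ ⟨h0, le_rfl⟩ h0
    · exact fun t ht => (hF t ht.1 (by linarith [ht.2])).continuousAt.continuousWithinAt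
    · rw [interior_Icc]
      exact fun t ht => (hF t ht.1.le (by linarith [ht.2])).differentiableAt.differentiableWithinAt
    · rw [interior_Icc]
      intro t ht
      rw [(hF t ht.1.le (by linarith [ht.2])).deriv]
      exact hF' t ht.1.le (by linarith [ht.2])
  have h1 : ∀ z : ℝ, 0 ≤ z → z < 1 →
      0 ≤ σ * (1 - z) ^ (-σ - 1) - σ * (1 + z) ^ (-σ - 1) - σ * (σ + 1) * (2 * z) := by
    intro z h0 h1
    have hk := key (fun z => (1 - z) ^ (-(σ + 1)) - (1 + z) ^ (-(σ + 1)) - (σ + 1) * 2 * z)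
      (fun z => (σ + 1) * (1 - z) ^ (-(σ + 1) - 1) - -(σ + 1) * (1 + z) ^ (-(σ + 1) - 1)
        - (σ + 1) * 2)
      (fun z h0 h1 => by
        have := ((hd2 (σ + 1) z h0 h1).sub (hd1 (σ + 1) z h0 h1)).sub
          ((hasDerivAt_id z).const_mul ((σ + 1) * 2))
        exact this.congr_deriv (by ring))
      (fun z h0 h1 => by
        have e1 := rpow_neg_ge_tangent (σ := σ + 2) (x := 1 - z) (y := 1) (by linarith)
          (by linarith) one_pos
        have e2 := rpow_neg_ge_tangent (σ := σ + 2) (x := 1 + z) (y := 1) (by linarith)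
          (by linarith) one_pos
        simp only [Real.one_rpow] at e1 e2
        rw [show -(σ + 1) - 1 = -(σ + 2) by ring]
        have := mul_nonneg (by linarith : 0 ≤ σ + 1)
          (by linarith : 0 ≤ (1 - z) ^ (-(σ + 2)) + (1 + z) ^ (-(σ + 2)) - 2)
        linarith) z h0 h1
    simp only [sub_zero, add_zero, Real.one_rpow, mul_zero, sub_self] at hk
    rw [show -(σ + 1) = -σ - 1 by ring] at hk
    have := mul_nonneg hσ hk
    linarith
  have hk := key (fun z => (1 + z) ^ (-σ) + (1 - z) ^ (-σ) - σ * (σ + 1) * z ^ 2)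
    (fun z => -σ * (1 + z) ^ (-σ - 1) + σ * (1 - z) ^ (-σ - 1) - σ * (σ + 1) * (2 * z))
    (fun z h0 h1 => by
      have := ((hd1 σ z h0 h1).add (hd2 σ z h0 h1)).sub
        ((hasDerivAt_pow 2 z).const_mul (σ * (σ + 1)))
      exact this.congr_deriv (by norm_num))
    (fun z h0 hz1 => by linarith [h1 z h0 hz1]) y hy0 hy1
  simp only [sub_zero, add_zero, Real.one_rpow] at hk
  norm_num at hk
  linarith

theorem rpow_neg_second_difference {σ v h : ℝ} (hσ : 0 ≤ σ) (hh : |h| < v) :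
    2 * v ^ (-σ) + σ * (σ + 1) * v ^ (-σ - 2) * h ^ 2 ≤ (v + h) ^ (-σ) + (v - h) ^ (-σ) := by
  have hv : 0 < v := (abs_nonneg h).trans_lt hh
  wlog h0 : 0 ≤ h generalizing h with H
  · have := H (h := -h) (by rwa [abs_neg]) (by linarith)
    rw [neg_sq, sub_neg_eq_add, ← sub_eq_add_neg] at this
    linarith
  rw [abs_of_nonneg h0] at hh
  have h1 := two_add_le_rpow_neg_add_rpow_neg hσ (div_nonneg h0 hv.le) ((div_lt_one hv).2 hh)
  have h2 := mul_le_mul_of_nonneg_left h1 (Real.rpow_nonneg hv.le (-σ))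
  have hq : h / v < 1 := (div_lt_one hv).2 hh
  have hq0 : 0 ≤ h / v := div_nonneg h0 hv.le
  rw [mul_add (v ^ (-σ)) ((1 + h / v) ^ (-σ)), ← Real.mul_rpow hv.le (by linarith),
    ← Real.mul_rpow hv.le (by linarith), mul_add v, mul_sub v, mul_one,
    mul_div_cancel₀ h hv.ne'] at h2
  refine le_trans (le_of_eq ?_) h2
  rw [Real.rpow_sub hv, Real.rpow_two]
  field_simp

/-- The function `(|w| ^ 2 - 2 d) ^ (-(d - 2) / 2)` is strictly subharmonic at a distance from
the origin. -/
theorem laplacian_rpow_neg_ge {d : ℕ} (hd : 3 ≤ d) {σ : ℝ} (hσ : 2 * σ = d - 2)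
    (w : Fin d → ℝ) {v : ℝ} (hv : v = ∑ i, w i ^ 2 - 2 * d) (hv0 : 2 * d + 4 ≤ v) :
    2 * d * σ * (v + 1) ^ (-σ - 2) ≤
      ∑ i, ((v + 1 + 2 * w i) ^ (-σ) + (v + 1 - 2 * w i) ^ (-σ) - 2 * v ^ (-σ)) := by
  have hd' : (3 : ℝ) ≤ d := by exact_mod_cast hd
  have hσ0 : 0 < σ := by linarith
  have hvpos : 0 < v := by linarith
  have hwi : ∀ i, |2 * w i| < v + 1 := by
    intro i
    have h1 : w i ^ 2 ≤ ∑ i, w i ^ 2 :=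
      Finset.single_le_sum (f := fun i => w i ^ 2) (fun i _ => sq_nonneg _) (Finset.mem_univ i)
    rw [abs_lt]
    constructor <;> nlinarith [sq_nonneg (w i - 2), sq_nonneg (w i + 2)]
  have hi : ∀ i ∈ Finset.univ, 2 * (v + 1) ^ (-σ) - 2 * v ^ (-σ) +
      σ * (σ + 1) * (v + 1) ^ (-σ - 2) * 4 * w i ^ 2 ≤
      (v + 1 + 2 * w i) ^ (-σ) + (v + 1 - 2 * w i) ^ (-σ) - 2 * v ^ (-σ) := by
    intro i _
    have := rpow_neg_second_difference hσ0.le (hwi i)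
    nlinarith
  refine le_trans ?_ (Finset.sum_le_sum hi)
  rw [Finset.sum_add_distrib, ← Finset.mul_sum, Finset.sum_const, Finset.card_univ,
    Fintype.card_fin, nsmul_eq_mul]
  have hρ : ∑ i, w i ^ 2 = v + 2 * d := by linarith
  rw [hρ]
  have h1 := rpow_neg_ge_tangent hσ0.le (by linarith : 0 < v + 1) hvpos
  have h2 := rpow_neg_ge_tangent (σ := σ + 1) (by linarith) (by linarith : 0 < v + 1) hvpos
  have e1 : v ^ (-σ - 1) = v * v ^ (-σ - 2) := by
    rw [show -σ - 1 = -σ - 2 + 1 by ring, Real.rpow_add_one hvpos.ne', mul_comm]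
  have e2 : (v + 1) ^ (-σ - 1) = (v + 1) * (v + 1) ^ (-σ - 2) := by
    rw [show -σ - 1 = -σ - 2 + 1 by ring, Real.rpow_add_one (by linarith), mul_comm]
  rw [show -(σ + 1) = -σ - 1 by ring, show -σ - 1 - 1 = -σ - 2 by ring, e1, e2] at h2
  rw [e1] at h1
  set X := v ^ (-σ - 2) with hX
  set Z := (v + 1) ^ (-σ - 2) with hZ
  have hX0 : 0 < X := Real.rpow_pos_of_pos hvpos _
  have hZ0 : 0 < Z := Real.rpow_pos_of_pos (by linarith) _
  have h3 : (v - (σ + 1)) * X ≤ (v + 1) * Z := by linarith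
  have hpoly : v * (v + 1) ≤ (v + 2 * d - 1) * (v - (σ + 1)) := by nlinarith
  have hpos : 0 < v - (σ + 1) := by linarith
  have h4 : v * X ≤ (v + 2 * d - 1) * Z := by
    have := mul_le_mul_of_nonneg_left h3 hvpos.le
    have := mul_le_mul_of_nonneg_right hpoly hZ0.le
    refine le_of_mul_le_mul_left ?_ hpos
    linarith
  have h5 := mul_le_mul_of_nonneg_left h4 (by positivity : 0 ≤ 2 * (d : ℝ) * σ)
  have h6 := mul_le_mul_of_nonneg_left h1 (by positivity : 0 ≤ 2 * (d : ℝ))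
  have h7 : (d : ℝ) = 2 * (σ + 1) := by linarith
  have h8 : σ * (σ + 1) * Z * 4 * (v + 2 * d) = 2 * d * σ * ((v + 2 * d) * Z) := by
    rw [h7]; ring
  rw [h8]
  linarith

section Torus

variable {L d : ℕ}

/-- The squared Euclidean distance to the origin on the torus. -/
def torusSq (s : Fin d → ZMod L) : ℝ := ∑ i, ((s i).valMinAbs : ℝ) ^ 2

/-- The graph distance to the origin on the torus. -/
def torusNorm (s : Fin d → ZMod L) : ℕ := ∑ i, (s i).valMinAbs.natAbs

/-- The graph Laplacian of the torus. -/
def torusLaplacian (f : (Fin d → ZMod L) → ℝ) (s : Fin d → ZMod L) : ℝ :=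
  ∑ i, (f (Function.update s i (s i + 1)) + f (Function.update s i (s i - 1)) - 2 * f s)

theorem natAbs_valMinAbs_add_intCast_le [NeZero L] (z : ZMod L) (e : ℤ) :
    (z + e).valMinAbs.natAbs ≤ (z.valMinAbs + e).natAbs :=
  ZMod.natAbs_min_of_le_div_two L _ _ (by simp) (ZMod.natAbs_valMinAbs_le _)

theorem torusSq_update_le [NeZero L] (s : Fin d → ZMod L) (i : Fin d) (e : ℤ) :
    torusSq (Function.update s i (s i + e)) ≤ torusSq s + 2 * e * (s i).valMinAbs + e ^ 2 := by
  unfold torusSq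
  rw [← Finset.add_sum_erase _ _ (Finset.mem_univ i),
    ← Finset.add_sum_erase _ (fun i => ((s i).valMinAbs : ℝ) ^ 2) (Finset.mem_univ i)]
  have h1 : ∑ j ∈ Finset.univ.erase i,
      ((Function.update s i (s i + e) j).valMinAbs : ℝ) ^ 2 =
      ∑ j ∈ Finset.univ.erase i, ((s j).valMinAbs : ℝ) ^ 2 :=
    Finset.sum_congr rfl fun j hj => by
      rw [Function.update_of_ne (Finset.ne_of_mem_erase hj)]
  rw [h1, Function.update_self]
  have h2 : (s i + e).valMinAbs ^ 2 ≤ ((s i).valMinAbs + e) ^ 2 :=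
    Int.natAbs_le_iff_sq_le.1 (natAbs_valMinAbs_add_intCast_le (s i) e)
  have h3 : ((s i + e).valMinAbs : ℝ) ^ 2 ≤ ((s i).valMinAbs + e) ^ 2 := by exact_mod_cast h2
  linarith

theorem abs_valMinAbs_le [NeZero L] (z : ZMod L) : |(z.valMinAbs : ℝ)| ≤ L / 2 := by
  have h := ZMod.valMinAbs_mem_Ioc z
  have h1 : (-L : ℝ) ≤ z.valMinAbs * 2 := by exact_mod_cast h.1.le
  have h2 : (z.valMinAbs : ℝ) * 2 ≤ L := by exact_mod_cast h.2
  rw [abs_le]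
  constructor <;> linarith

theorem torusSq_le [NeZero L] (s : Fin d → ZMod L) : torusSq s ≤ d * (L / 2) ^ 2 := by
  unfold torusSq
  refine (Finset.sum_le_card_nsmul Finset.univ _ (((L : ℝ) / 2) ^ 2) fun i _ => ?_).trans ?_
  · exact sq_le_sq' (by linarith [(abs_le.1 (abs_valMinAbs_le (s i))).1])
      (abs_le.1 (abs_valMinAbs_le (s i))).2
  · simp

theorem torusNorm_le_torusSq (s : Fin d → ZMod L) : (torusNorm s : ℝ) ≤ torusSq s := by
  unfold torusNorm torusSq
  push_cast
  refine Finset.sum_le_sum fun i _ => ?_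
  have h : (s i).valMinAbs.natAbs ≤ (s i).valMinAbs.natAbs ^ 2 := Nat.le_self_pow two_ne_zero _
  have h1 : ((s i).valMinAbs.natAbs : ℤ) ≤ (s i).valMinAbs ^ 2 := by
    rw [← Int.natAbs_sq]; exact_mod_cast h
  rw [Int.natCast_natAbs] at h1
  rw [Nat.cast_natAbs]
  exact_mod_cast h1

theorem torusSq_neg (s : Fin d → ZMod L) : torusSq (-s) = torusSq s := by
  refine Finset.sum_congr rfl fun i _ => ?_
  have h := ZMod.natAbs_valMinAbs_neg (s i)
  have h1 : (-s i).valMinAbs ^ 2 = (s i).valMinAbs ^ 2 := by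
    rw [← Int.natAbs_sq, h, Int.natAbs_sq]
  exact_mod_cast h1

theorem torusNorm_neg (s : Fin d → ZMod L) : torusNorm (-s) = torusNorm s :=
  Finset.sum_congr rfl fun i _ => ZMod.natAbs_valMinAbs_neg (s i)

theorem torusNorm_update [NeZero L] (s : Fin d → ZMod L) (i : Fin d) (z : ZMod L) :
    torusNorm (Function.update s i z) + (s i).valMinAbs.natAbs =
      torusNorm s + z.valMinAbs.natAbs := by
  unfold torusNorm
  rw [← Finset.add_sum_erase _ _ (Finset.mem_univ i),
    ← Finset.add_sum_erase _ (fun i => (s i).valMinAbs.natAbs) (Finset.mem_univ i)]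
  have h1 : ∑ j ∈ Finset.univ.erase i, (Function.update s i z j).valMinAbs.natAbs =
      ∑ j ∈ Finset.univ.erase i, (s j).valMinAbs.natAbs :=
    Finset.sum_congr rfl fun j hj => by
      rw [Function.update_of_ne (Finset.ne_of_mem_erase hj)]
  rw [h1, Function.update_self]
  omega

/-- Away from the origin, some neighbour is closer to the origin. -/
theorem exists_torusNorm_update_lt [NeZero L] {s : Fin d → ZMod L} (hs : s ≠ 0) :
    ∃ i, torusNorm (Function.update s i (s i + 1)) + 1 ≤ torusNorm s ∨
      torusNorm (Function.update s i (s i - 1)) + 1 ≤ torusNorm s := by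
  obtain ⟨i, hi⟩ := Function.ne_iff.1 hs
  have hw : (s i).valMinAbs ≠ 0 := fun h => hi ((ZMod.valMinAbs_eq_zero _).1 h)
  refine ⟨i, ?_⟩
  rcases lt_or_gt_of_ne hw with h | h
  · left
    have h1 := natAbs_valMinAbs_add_intCast_le (s i) 1
    have h2 := torusNorm_update s i (s i + 1)
    push_cast at h1
    omega
  · right
    have h1 := natAbs_valMinAbs_add_intCast_le (s i) (-1)
    have h2 := torusNorm_update s i (s i - 1)
    push_cast at h1
    rw [← sub_eq_add_neg] at h1
    omega

theorem torusLaplacian_pow_ge [NeZero L] {q : ℝ} (hq0 : 0 < q) (hq : q * (2 * d + 1) = 1)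
    {s : Fin d → ZMod L} (hs : s ≠ 0) :
    q ^ torusNorm s ≤ torusLaplacian (fun s => q ^ torusNorm s) s := by
  obtain ⟨i, hi⟩ := exists_torusNorm_update_lt hs
  have hq1 : q ≤ 1 := by nlinarith [mul_nonneg hq0.le (Nat.cast_nonneg (α := ℝ) d)]
  have hkey : ∀ m : ℕ, m + 1 ≤ torusNorm s → (2 * d + 1) * q ^ torusNorm s ≤ q ^ m := by
    intro m hm
    have h1 := pow_le_pow_of_le_one hq0.le hq1 hm
    rw [pow_succ] at h1
    have h2 := mul_le_mul_of_nonneg_left h1 (by positivity : (0 : ℝ) ≤ 2 * d + 1)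
    have h3 : (2 * (d : ℝ) + 1) * (q ^ m * q) = q ^ m := by
      rw [mul_comm (q ^ m), ← mul_assoc, mul_comm _ q, hq, one_mul]
    rwa [h3] at h2
  have h1 : (2 * d + 1) * q ^ torusNorm s ≤ q ^ torusNorm (Function.update s i (s i + 1)) +
      q ^ torusNorm (Function.update s i (s i - 1)) := by
    have p1 : 0 < q ^ torusNorm (Function.update s i (s i + 1)) := by positivity
    have p2 : 0 < q ^ torusNorm (Function.update s i (s i - 1)) := by positivity
    rcases hi with hi | hi
    · linarith [hkey _ hi]
    · linarith [hkey _ hi]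
  have h2 : (2 * d + 1) * q ^ torusNorm s ≤ ∑ i, (q ^ torusNorm (Function.update s i (s i + 1)) +
      q ^ torusNorm (Function.update s i (s i - 1))) :=
    h1.trans (Finset.single_le_sum (f := fun i => q ^ torusNorm (Function.update s i (s i + 1)) +
      q ^ torusNorm (Function.update s i (s i - 1))) (fun i _ => by positivity) (Finset.mem_univ i))
  unfold torusLaplacian
  rw [Finset.sum_sub_distrib, Finset.sum_const, Finset.card_univ, Fintype.card_fin, nsmul_eq_mul]
  linarith

/-- The radial profile of a function that is strictly subharmonic at a distance from the origin
of the torus. -/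
def torusProfile (L d : ℕ) (σ : ℝ) (r : ℝ) : ℝ :=
  (r - 2 * d) ^ (-σ) + σ * (d : ℝ) ^ (-σ - 1) / (L : ℝ) ^ d * r

theorem torusProfile_anti [NeZero L] (hd : 3 ≤ d) {σ : ℝ} (hσ : 2 * σ = d - 2) {r r' : ℝ}
    (hr : 2 * d + 1 ≤ r) (hrr : r ≤ r') (hr' : r' ≤ d * (L : ℝ) ^ 2) :
    torusProfile L d σ r' ≤ torusProfile L d σ r := by
  have hd' : (3 : ℝ) ≤ d := by exact_mod_cast hd
  have hL : (0 : ℝ) < L := by exact_mod_cast NeZero.pos L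
  have hσ0 : 0 < σ := by linarith
  have h1 := rpow_neg_ge_tangent hσ0.le (by linarith : 0 < r - 2 * d)
    (by linarith : 0 < r' - 2 * d)
  have h2 : (d : ℝ) ^ (-σ - 1) / (L : ℝ) ^ d ≤ (r' - 2 * d) ^ (-σ - 1) := by
    have h3 : (d * (L : ℝ) ^ 2) ^ (-σ - 1) ≤ (r' - 2 * d) ^ (-σ - 1) :=
      Real.rpow_le_rpow_of_nonpos (by linarith) (by linarith) (by linarith)
    rw [Real.mul_rpow (by positivity) (by positivity), ← Real.rpow_natCast, ← Real.rpow_mul hL.le]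
      at h3
    rwa [show ((2 : ℕ) : ℝ) * (-σ - 1) = -(d : ℝ) by push_cast; linarith, Real.rpow_neg hL.le,
      Real.rpow_natCast, ← div_eq_mul_inv] at h3
  have h4 := mul_le_mul_of_nonneg_right (mul_le_mul_of_nonneg_left h2 hσ0.le)
    (sub_nonneg.2 hrr)
  unfold torusProfile
  rw [mul_div_assoc]
  linarith

theorem torusLaplacian_profile_ge [NeZero L] (hL : 3 ≤ L) (hd : 3 ≤ d) {σ : ℝ}
    (hσ : 2 * σ = d - 2) {s : Fin d → ZMod L} (hs : 4 * d + 4 ≤ torusSq s) :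
    2 * d * σ * (torusSq s - 2 * d + 1) ^ (-σ - 2) +
        2 * d * (σ * (d : ℝ) ^ (-σ - 1) / (L : ℝ) ^ d) ≤
      torusLaplacian (fun s => torusProfile L d σ (max (torusSq s) (2 * d + 1))) s := by
  have hd' : (3 : ℝ) ≤ d := by exact_mod_cast hd
  have hL' : (3 : ℝ) ≤ L := by exact_mod_cast hL
  have h1 := laplacian_rpow_neg_ge hd hσ (fun i => ((s i).valMinAbs : ℝ))
    (v := torusSq s - 2 * d) rfl (by linarith)
  set B := σ * (d : ℝ) ^ (-σ - 1) / (L : ℝ) ^ d with hB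
  have hstep : ∀ (i : Fin d) (e : ℤ), e = 1 ∨ e = -1 →
      torusProfile L d σ (torusSq s + 2 * e * (s i).valMinAbs + 1) ≤
      torusProfile L d σ (max (torusSq (Function.update s i (s i + e))) (2 * d + 1)) := by
    intro i e he
    have h2 := torusSq_update_le s i e
    have he2 : (e : ℝ) ^ 2 = 1 := by rcases he with rfl | rfl <;> norm_num
    rw [he2] at h2
    have h3 : ((s i).valMinAbs : ℝ) ^ 2 ≤ torusSq s :=
      Finset.single_le_sum (f := fun i => ((s i).valMinAbs : ℝ) ^ 2) (fun i _ => sq_nonneg _)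
        (Finset.mem_univ i)
    have h4 : 2 * e * ((s i).valMinAbs : ℝ) ≤ L := by
      have := abs_le.1 (abs_valMinAbs_le (s i))
      rcases he with rfl | rfl
      · push_cast; linarith
      · push_cast; linarith
    refine torusProfile_anti hd hσ (le_max_right _ _) (max_le h2 ?_) ?_
    · rcases he with rfl | rfl
      · push_cast; nlinarith [sq_nonneg (((s i).valMinAbs : ℝ) + 2)]
      · push_cast; nlinarith [sq_nonneg (((s i).valMinAbs : ℝ) - 2)]
    · have := torusSq_le s
      have h5 : (3 : ℝ) * L ^ 2 ≤ d * L ^ 2 := mul_le_mul_of_nonneg_right hd' (by positivity)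
      nlinarith
  have hmax : max (torusSq s) (2 * d + 1) = torusSq s := max_eq_left (by linarith)
  have hi : ∀ i ∈ Finset.univ, ((torusSq s - 2 * d + 1 + 2 * (s i).valMinAbs) ^ (-σ) +
      (torusSq s - 2 * d + 1 - 2 * (s i).valMinAbs) ^ (-σ) - 2 * (torusSq s - 2 * d) ^ (-σ)) +
        2 * B ≤
      torusProfile L d σ (max (torusSq (Function.update s i (s i + 1))) (2 * d + 1)) +
      torusProfile L d σ (max (torusSq (Function.update s i (s i - 1))) (2 * d + 1)) -
      2 * torusProfile L d σ (max (torusSq s) (2 * d + 1)) := by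
    intro i _
    have e1 := hstep i 1 (Or.inl rfl)
    have e2 := hstep i (-1) (Or.inr rfl)
    push_cast at e1 e2
    rw [← sub_eq_add_neg] at e2
    rw [hmax]
    unfold torusProfile at e1 e2 ⊢
    rw [← hB] at e1 e2 ⊢
    rw [show torusSq s + 2 * 1 * ((s i).valMinAbs : ℝ) + 1 - 2 * d =
      torusSq s - 2 * d + 1 + 2 * (s i).valMinAbs by ring] at e1
    rw [show torusSq s + 2 * -1 * ((s i).valMinAbs : ℝ) + 1 - 2 * d =
      torusSq s - 2 * d + 1 - 2 * (s i).valMinAbs by ring] at e2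
    linarith
  have h6 := Finset.sum_le_sum hi
  rw [Finset.sum_add_distrib, Finset.sum_const, Finset.card_univ, Fintype.card_fin,
    nsmul_eq_mul] at h6
  unfold torusLaplacian
  linarith

end Torus

/-- For a suitable additive constant, the radial profile satisfies the differential inequality
at a distance from the origin, as soon as the torus is large. -/
theorem exists_torusProfile_subsolution {d : ℕ} (hd : 3 ≤ d) {σ B : ℝ} (hσ : 2 * σ = d - 2)
    (hB : B = σ * (d : ℝ) ^ (-σ - 1)) {A : ℝ} (hA : 0 < A) :
    ∃ L₀ : ℝ, ∀ L : ℕ, L₀ ≤ L → ∀ [NeZero L], ∀ s : Fin d → ZMod L, 4 * d + 4 ≤ torusSq s →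
      A / (L : ℝ) ^ d * (d * B / A + torusProfile L d σ (max (torusSq s) (2 * d + 1))) ≤
        torusLaplacian (fun s => torusProfile L d σ (max (torusSq s) (2 * d + 1))) s := by
  have hd' : (3 : ℝ) ≤ d := by exact_mod_cast hd
  have hσ0 : 0 < σ := by linarith
  have hB0 : 0 < B := by rw [hB]; positivity
  obtain ⟨v₁, hv₁, hv₁'⟩ : ∃ v₁ : ℝ, 0 < v₁ ∧ v₁ ^ (-σ) ≤ d * B / (2 * A) := by
    have := (tendsto_rpow_neg_atTop hσ0).eventually
      (ge_mem_nhds (show 0 < d * B / (2 * A) by positivity))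
    obtain ⟨v₁, h1, h2⟩ := (this.and (Filter.eventually_gt_atTop 0)).exists
    exact ⟨v₁, h2, h1⟩
  set ζ := 2 * d * σ * (v₁ + 1) ^ (-σ - 2) with hζ
  have hζ0 : 0 < ζ := by positivity
  refine ⟨3 + 2 * A + A / ζ, fun L hL _ s hs => ?_⟩
  have hAζ : 0 < A / ζ := by positivity
  have hL1 : (3 : ℝ) ≤ L := by linarith
  have hL3 : 3 ≤ L := by exact_mod_cast hL1
  refine le_trans ?_ (torusLaplacian_profile_ge hL3 hd hσ hs)
  rw [max_eq_left (by linarith), torusProfile, ← hB]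
  set n : ℝ := (L : ℝ) ^ d with hn
  set r := torusSq s with hr
  have hL0 : (0 : ℝ) < L := by linarith
  have hn0 : 0 < n := by positivity
  have hLn : (L : ℝ) ^ 2 * L ≤ n := by
    rw [← pow_succ]; exact pow_le_pow_right₀ (by linarith) hd
  have hrL : r ≤ d * (L : ℝ) ^ 2 := by
    have h1 := torusSq_le s
    have h2 : (0 : ℝ) ≤ d * (L : ℝ) ^ 2 := by positivity
    linarith
  have h1 : A * (B / n * r) ≤ d * B / 2 := by
    have h2 : A * r ≤ d / 2 * n := by
      have h3 := mul_le_mul_of_nonneg_left hrL hA.le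
      have h4 : 2 * A * (L : ℝ) ^ 2 ≤ n := by
        have := mul_le_mul_of_nonneg_left (by linarith : 2 * A ≤ L) (sq_nonneg (L : ℝ))
        linarith
      have h5 := mul_le_mul_of_nonneg_left h4 (by positivity : (0 : ℝ) ≤ d / 2)
      linarith
    rw [div_mul_eq_mul_div, mul_div_assoc', div_le_iff₀ hn0]
    have := mul_le_mul_of_nonneg_left h2 hB0.le
    linarith
  have hv : 0 < r - 2 * d := by linarith
  have h0 : 0 ≤ 2 * d * σ * (r - 2 * d + 1) ^ (-σ - 2) :=
    mul_nonneg (by positivity) (Real.rpow_nonneg (by linarith) _)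
  have hexp : A / n * (d * B / A + ((r - 2 * d) ^ (-σ) + B / n * r)) =
      1 / n * (d * B + A * (B / n * r)) + A / n * (r - 2 * d) ^ (-σ) := by
    field_simp
    ring
  have h2 : 1 / n * (d * B + A * (B / n * r)) ≤ 1 / n * (d * B + d * B / 2) :=
    mul_le_mul_of_nonneg_left (by linarith) (by positivity)
  have h3 : 2 * d * (B / n) = 1 / n * (d * B + d * B / 2) + 1 / n * (d * B / 2) := by ring
  rw [hexp, h3]
  have h4 : 0 ≤ 1 / n * (d * B / 2) := by positivity
  rcases le_or_gt v₁ (r - 2 * d) with hvv | hvv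
  · have h5 : (r - 2 * d) ^ (-σ) ≤ d * B / (2 * A) :=
      (Real.rpow_le_rpow_of_nonpos hv₁ hvv (by linarith)).trans hv₁'
    have h6 : A / n * (r - 2 * d) ^ (-σ) ≤ A / n * (d * B / (2 * A)) :=
      mul_le_mul_of_nonneg_left h5 (by positivity)
    have h7 : A / n * (d * B / (2 * A)) = 1 / n * (d * B / 2) := by field_simp
    linarith
  · have h5 : (r - 2 * d) ^ (-σ) ≤ 1 :=
      Real.rpow_le_one_of_one_le_of_nonpos (by linarith) (by linarith)
    have h6 : A / n * (r - 2 * d) ^ (-σ) ≤ A / n :=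
      mul_le_of_le_one_right (by positivity) h5
    have h7 : A / n ≤ ζ := by
      rw [div_le_iff₀ hn0]
      have h8 : A ≤ L * ζ := (div_le_iff₀ hζ0).1 (by linarith)
      have h9 : (L : ℝ) ≤ n := by nlinarith
      have := mul_le_mul_of_nonneg_right h9 hζ0.le
      linarith
    have h8 : ζ ≤ 2 * d * σ * (r - 2 * d + 1) ^ (-σ - 2) :=
      mul_le_mul_of_nonneg_left
        (Real.rpow_le_rpow_of_nonpos (by linarith) (by linarith) (by linarith)) (by positivity)
    linarith

theorem torusLaplacian_mono_of_eq {L d : ℕ} {f g : (Fin d → ZMod L) → ℝ} (h : ∀ s, g s ≤ f s)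
    {s : Fin d → ZMod L} (hs : f s = g s) : torusLaplacian g s ≤ torusLaplacian f s := by
  refine Finset.sum_le_sum fun i _ => ?_
  rw [hs]
  linarith [h (Function.update s i (s i + 1)), h (Function.update s i (s i - 1))]

theorem torusLaplacian_affine {L d : ℕ} (β κ : ℝ) (f : (Fin d → ZMod L) → ℝ)
    (s : Fin d → ZMod L) :
    torusLaplacian (fun s => κ * (β + f s)) s = κ * torusLaplacian f s := by
  unfold torusLaplacian
  rw [Finset.mul_sum]
  exact Finset.sum_congr rfl fun i _ => by ring

theorem torusProfile_le {L d : ℕ} [NeZero L] (hd : 3 ≤ d) (hL : 3 ≤ L) {σ B : ℝ}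
    (hσ : 2 * σ = d - 2) (hB : B = σ * (d : ℝ) ^ (-σ - 1)) (s : Fin d → ZMod L) :
    torusProfile L d σ (max (torusSq s) (2 * d + 1)) ≤ 1 + d * B := by
  have hd' : (3 : ℝ) ≤ d := by exact_mod_cast hd
  have hL' : (3 : ℝ) ≤ L := by exact_mod_cast hL
  have hσ0 : 0 < σ := by linarith
  have hB0 : 0 < B := by rw [hB]; positivity
  have hr1 : 2 * (d : ℝ) + 1 ≤ max (torusSq s) (2 * d + 1) := le_max_right _ _
  have hr2 : max (torusSq s) (2 * d + 1) ≤ d * (L : ℝ) ^ 2 := by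
    have h9 : (9 : ℝ) ≤ L ^ 2 := by nlinarith
    have := mul_le_mul_of_nonneg_left h9 (by positivity : (0 : ℝ) ≤ d)
    refine max_le ((torusSq_le s).trans ?_) (by linarith)
    have h2 : (0 : ℝ) ≤ d * (L : ℝ) ^ 2 := by positivity
    linarith
  set r := max (torusSq s) (2 * d + 1) with hr
  unfold torusProfile
  rw [← hB]
  refine add_le_add (Real.rpow_le_one_of_one_le_of_nonpos (by linarith) (by linarith)) ?_
  have hn : (L : ℝ) ^ 2 ≤ (L : ℝ) ^ d := pow_le_pow_right₀ (by linarith) (by omega)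
  rw [div_mul_eq_mul_div, div_le_iff₀ (by positivity)]
  have h3 : r ≤ d * (L : ℝ) ^ d := hr2.trans (mul_le_mul_of_nonneg_left hn (by positivity))
  have := mul_le_mul_of_nonneg_left h3 hB0.le
  linarith

theorem torusProfile_nonneg {L d : ℕ} {σ : ℝ} (hσ0 : 0 ≤ σ) {r : ℝ} (hr : 2 * (d : ℝ) + 1 ≤ r) :
    0 ≤ torusProfile L d σ r := by
  unfold torusProfile
  have h1 : 0 ≤ (r - 2 * d) ^ (-σ) := Real.rpow_nonneg (by linarith) _
  have h2 : 0 ≤ r := by have := Nat.cast_nonneg (α := ℝ) d; linarith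
  positivity

/-- On the torus there are functions with values in `[γ / A, 1]` which satisfy
`A / L ^ d * f ≤ Δ f` except at the origin. -/
theorem exists_torus_subsolution {d : ℕ} (hd : 3 ≤ d) :
    ∃ γ : ℝ, 0 < γ ∧ ∀ A : ℝ, 1 ≤ A → ∃ L₀ : ℝ, ∀ L : ℕ, L₀ ≤ L → ∀ [NeZero L],
      ∃ f : (Fin d → ZMod L) → ℝ, (∀ s, γ / A ≤ f s) ∧ (∀ s, f s ≤ 1) ∧ (∀ s, f (-s) = f s) ∧
        ∀ s, s ≠ 0 → A / (L : ℝ) ^ d * f s ≤ torusLaplacian f s := by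
  have hd' : (3 : ℝ) ≤ d := by exact_mod_cast hd
  obtain ⟨σ, hσ⟩ : ∃ σ : ℝ, 2 * σ = d - 2 := ⟨(d - 2) / 2, by ring⟩
  have hσ0 : 0 < σ := by linarith
  set B := σ * (d : ℝ) ^ (-σ - 1) with hB
  have hB0 : 0 < B := by positivity
  set q : ℝ := 1 / (2 * d + 1) with hq
  have hq0 : 0 < q := by positivity
  have hq1 : q * (2 * d + 1) = 1 := by rw [hq]; field_simp
  have hqle : q ≤ 1 := by nlinarith
  set κ : ℝ := q ^ (4 * d + 4) / (1 + 2 * d * B) with hκ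
  have hκ0 : 0 < κ := by positivity
  refine ⟨κ * (d * B), by positivity, fun A hA => ?_⟩
  obtain ⟨L₀, hL₀⟩ := exists_torusProfile_subsolution hd hσ hB (by linarith : 0 < A)
  refine ⟨max (max L₀ 3) A, fun L hL _ => ?_⟩
  have hL₀L : L₀ ≤ L := ((le_max_left _ _).trans (le_max_left _ _)).trans hL
  have hL3 : (3 : ℝ) ≤ L := ((le_max_right _ _).trans (le_max_left _ _)).trans hL
  have hLA : A ≤ L := (le_max_right _ _).trans hL
  have hL3' : 3 ≤ L := by exact_mod_cast hL3
  set F : (Fin d → ZMod L) → ℝ :=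
    fun s => κ * (d * B / A + torusProfile L d σ (max (torusSq s) (2 * d + 1))) with hF
  set g : (Fin d → ZMod L) → ℝ := fun s => q ^ torusNorm s with hg
  have hFle : ∀ s, F s ≤ q ^ (4 * d + 4) := by
    intro s
    have h1 := torusProfile_le hd hL3' hσ hB s
    have h2 : d * B / A ≤ d * B := div_le_self (by positivity) hA
    have h3 := mul_le_mul_of_nonneg_left (by linarith : d * B / A +
      torusProfile L d σ (max (torusSq s) (2 * d + 1)) ≤ 1 + 2 * d * B) hκ0.le
    refine h3.trans (le_of_eq ?_)
    rw [hκ]; field_simp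
  refine ⟨fun s => max (g s) (F s), fun s => ?_, fun s => ?_, fun s => ?_, fun s hs => ?_⟩
  · refine le_trans ?_ (le_max_right _ _)
    rw [mul_div_assoc]
    have := torusProfile_nonneg (L := L) hσ0.le (le_max_right (torusSq s) (2 * (d : ℝ) + 1))
    exact mul_le_mul_of_nonneg_left (by linarith) hκ0.le
  · exact max_le (pow_le_one₀ hq0.le hqle) ((hFle s).trans (pow_le_one₀ hq0.le hqle))
  · simp only [hg, hF, torusNorm_neg, torusSq_neg]
  · rcases le_or_gt (F s) (g s) with hFg | hFg
    · change A / (L : ℝ) ^ d * max (g s) (F s) ≤ _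
      have hmax : max (g s) (F s) = g s := max_eq_left hFg
      refine le_trans ?_ (torusLaplacian_mono_of_eq (fun s => le_max_left _ _) hmax)
      rw [hmax]
      refine le_trans ?_ (torusLaplacian_pow_ge hq0 hq1 hs)
      refine mul_le_of_le_one_left (by positivity) ?_
      rw [div_le_one (by positivity)]
      exact hLA.trans (le_self_pow₀ (by linarith) (by omega))
    · change A / (L : ℝ) ^ d * max (g s) (F s) ≤ _
      have hmax : max (g s) (F s) = F s := max_eq_right hFg.le
      refine le_trans ?_ (torusLaplacian_mono_of_eq (fun s => le_max_right _ _) hmax)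
      have hbig : 4 * (d : ℝ) + 4 ≤ torusSq s := by
        by_contra hlt
        push Not at hlt
        have h1 : (torusNorm s : ℝ) ≤ ((4 * d + 4 : ℕ) : ℝ) := by
          push_cast
          exact (torusNorm_le_torusSq s).trans hlt.le
        have h2 : q ^ (4 * d + 4) ≤ g s :=
          pow_le_pow_of_le_one hq0.le hqle (by exact_mod_cast h1)
        linarith [hFle s]
      rw [hmax, torusLaplacian_affine]
      have := mul_le_mul_of_nonneg_left (hL₀ L hL₀L s hbig) hκ0.le
      refine le_trans (le_of_eq ?_) this
      simp only [hF]
      ring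

/-- The neighbours of `a` in the torus graph are the `2 * d` vertices `a ± e_i`. -/
theorem torusGraph_adj_iff {L d : ℕ} (hL : 3 ≤ L) (a v : Fin d → ZMod L) :
    (torusGraph L d).Adj a v ↔
      ∃ i, v = Function.update a i (a i + 1) ∨ v = Function.update a i (a i - 1) := by
  have h1 : (1 : ZMod L) ≠ 0 := by
    have : Fact (1 < L) := ⟨by omega⟩
    exact one_ne_zero
  have e1 : ∀ (u : Fin d → ZMod L) (i : Fin d),
      (u + fun j => if j = i then (1 : ZMod L) else 0) = Function.update u i (u i + 1) := by
    intro u i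
    funext j
    by_cases hj : j = i
    · subst hj; simp
    · simp [hj]
  have e2 : ∀ (u w : Fin d → ZMod L) (i : Fin d),
      u = Function.update w i (w i + 1) ↔ w = Function.update u i (u i - 1) := by
    intro u w i
    constructor <;> · rintro rfl; simp
  simp only [torusGraph, SimpleGraph.fromRel_adj, e1]
  constructor
  · rintro ⟨-, ⟨i, h⟩ | ⟨i, h⟩⟩
    · exact ⟨i, Or.inl h⟩
    · exact ⟨i, Or.inr ((e2 _ _ _).1 h)⟩
  · rintro ⟨i, h | h⟩
    · refine ⟨?_, Or.inl ⟨i, h⟩⟩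
      rintro rfl
      have := congrFun h i
      simp [h1] at this
    · refine ⟨?_, Or.inr ⟨i, (e2 _ _ _).2 h⟩⟩
      rintro rfl
      have := congrFun h i
      rw [Function.update_self, eq_comm, sub_eq_self] at this
      exact h1 this

/-- The neighbour set of `a` in the torus graph, parametrized by direction and sign. -/
theorem filter_torusGraph_adj {L d : ℕ} [NeZero L] (hL : 3 ≤ L) (a : Fin d → ZMod L) :
    Finset.univ.filter ((torusGraph L d).Adj a) =
      (Finset.univ : Finset (Fin d × Bool)).image fun ib =>
        Function.update a ib.1 (if ib.2 then a ib.1 + 1 else a ib.1 - 1) := by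
  ext v
  simp only [Finset.mem_filter, Finset.mem_univ, true_and, Finset.mem_image, Prod.exists,
    torusGraph_adj_iff hL, Bool.exists_bool, if_true, Bool.false_eq_true, if_false]
  exact exists_congr fun i => by rw [or_comm, @eq_comm _ v, @eq_comm _ v]

theorem card_filter_torusGraph_adj_le {L d : ℕ} [NeZero L] (hL : 3 ≤ L) (a : Fin d → ZMod L) :
    (Finset.univ.filter ((torusGraph L d).Adj a)).card ≤ 2 * d := by
  rw [filter_torusGraph_adj hL]
  refine Finset.card_image_le.trans (le_of_eq ?_)
  simp [mul_comm]

/-- The graph Laplacian of the torus graph is `torusLaplacian`. -/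
theorem sum_torusGraph_adj_sub {L d : ℕ} [NeZero L] (hL : 3 ≤ L) (f : (Fin d → ZMod L) → ℝ)
    (a t : Fin d → ZMod L) :
    ∑ v ∈ Finset.univ.filter ((torusGraph L d).Adj a), (f (v - t) - f (a - t)) =
      torusLaplacian f (a - t) := by
  have h1 : (1 : ZMod L) ≠ 0 := by
    have : Fact (1 < L) := ⟨by omega⟩
    exact one_ne_zero
  have h2 : (1 : ZMod L) ≠ -1 := by
    have : Fact (2 < L) := ⟨by omega⟩
    exact (ZMod.neg_one_ne_one).symm
  rw [filter_torusGraph_adj hL, Finset.sum_image]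
  · rw [Fintype.sum_prod_type, torusLaplacian]
    refine Finset.sum_congr rfl fun i _ => ?_
    have e : ∀ z : ZMod L, Function.update a i (a i + z) - t =
        Function.update (a - t) i ((a - t) i + z) := by
      intro z
      funext j
      by_cases hj : j = i
      · subst hj; simp; ring
      · simp [hj]
    simp only [Fintype.sum_bool, if_true, Bool.false_eq_true, if_false]
    rw [e, sub_eq_add_neg (a i), e, ← sub_eq_add_neg]
    ring
  · rintro ⟨i, b⟩ - ⟨j, b'⟩ - h
    simp only at h
    have hne : ∀ b : Bool, ∀ z : ZMod L, (if b then z + 1 else z - 1) ≠ z := by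
      intro b z
      cases b <;> simp [h1]
    have hij : i = j := by
      by_contra hij
      have := congrFun h i
      rw [Function.update_self, Function.update_of_ne hij] at this
      exact hne b _ this
    subst hij
    have := congrFun h i
    rw [Function.update_self, Function.update_self] at this
    have hb : b = b' := by
      cases b <;> cases b' <;> simp [sub_eq_add_neg] at this ⊢
      · exact h2 this.symm
      · exact h2 this
    rw [hb]

theorem inv_one_add_pow_floor_le {h r : ℝ} (hh0 : 0 ≤ h) (hh1 : h ≤ 1) (hr : 2 ≤ r) :
    ((1 + h)⁻¹) ^ ⌊r⌋₊ ≤ Real.exp (-(h * r / 4)) := by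
  have h1 : (1 + h)⁻¹ ≤ Real.exp (-(h / 2)) := by
    have h2 := Real.add_one_le_exp (-(h / (1 + h)))
    have h3 : -(h / (1 + h)) + 1 = (1 + h)⁻¹ := by field_simp; ring
    rw [h3] at h2
    refine h2.trans (Real.exp_le_exp.2 (neg_le_neg ?_))
    exact div_le_div_of_nonneg_left hh0 (by positivity) (by linarith)
  refine (pow_le_pow_left₀ (by positivity) h1 _).trans ?_
  rw [← Real.exp_nat_mul]
  refine Real.exp_le_exp.2 ?_
  have h4 := Nat.lt_floor_add_one r
  nlinarith

theorem exists_one_le_mul_exp_le {b δ : ℝ} (hb : 0 < b) (hδ : 0 < δ) (A₀ : ℝ) :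
    ∃ A : ℝ, 1 ≤ A ∧ A₀ ≤ A ∧ Real.exp (-(b * A)) ≤ δ / A := by
  have h1 := (Real.tendsto_pow_mul_exp_neg_atTop_nhds_zero 1).comp
    (Filter.tendsto_id.const_mul_atTop hb)
  have h2 := h1.eventually (gt_mem_nhds (show (0 : ℝ) < b * δ by positivity))
  obtain ⟨A, hA, hA1, hA0⟩ :=
    (h2.and ((Filter.eventually_ge_atTop 1).and (Filter.eventually_ge_atTop A₀))).exists
  refine ⟨A, hA1, hA0, ?_⟩
  have hA' : 0 < A := by linarith
  simp only [Function.comp_apply, id, pow_one] at hA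
  rw [le_div_iff₀ hA']
  refine le_of_mul_le_mul_left ?_ hb
  calc b * (Real.exp (-(b * A)) * A) = b * A * Real.exp (-(b * A)) := by ring
    _ ≤ b * δ := hA.le

/-- For parameters scaling as in the theorem, `half_numComponents_mul_le_expDrops` applies. -/
theorem half_numComponents_mul_le_expDrops_of_scaling {V : Type*} [Fintype V] [Nonempty V]
    {G : SimpleGraph V} {k : ℕ} {c ε A n : ℝ} {f : V → V → ℝ} (hn : (Fintype.card V : ℝ) = n)
    (hc : 0 < c) (hε : 0 < ε)
    (hk : ∀ a, (Finset.univ.filter (G.Adj a)).card ≤ k)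
    (hA : 8 * k * (2 * k * c + 1) ≤ A) (hA0 : 0 ≤ A)
    (hn1 : 1 + 2 * c + 2 * (2 * k * c + 1) + c * A / 4 + 2 / ε ≤ n)
    {δ : ℝ} (hδ : 0 ≤ δ) (hf0 : ∀ s t, δ ≤ f s t)
    (hf1 : ∀ s t, f s t ≤ 1) (hfs : ∀ s t, f s t = f t s)
    (hsub : ∀ a t, a ≠ t →
      A / n * f a t ≤ ∑ v ∈ Finset.univ.filter (G.Adj a), (f v t - f a t))
    (x : V → Bool) :
    ((numComponents G x / 2 : ℕ) : ℝ) *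
        ((1 / 4) ^ (2 * k) * δ - Real.exp (-(c * ε / 16 * A))) ≤
      2 * k * expDrops (kcipKernel G (c / n)) (numComponents G) x ⌊ε * n ^ 3⌋₊ := by
  have hk0 : (0 : ℝ) ≤ k := Nat.cast_nonneg k
  have hkc : 0 ≤ 2 * k * c := by positivity
  have hcA : 0 ≤ c * A := by positivity
  have hε2 : 0 < 2 / ε := by positivity
  have hn0 : 1 ≤ n := by linarith
  have hnpos : 0 < n := by linarith
  have hnsq : n ≤ n ^ 2 := le_self_pow₀ hn0 (by norm_num)
  have hncube : n ≤ n ^ 3 := le_self_pow₀ hn0 (by norm_num)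
  have hη : (2 * k * c + 1) / n ≤ 1 / 2 := by
    rw [div_le_iff₀ hnpos]; linarith
  refine le_trans (mul_le_mul_of_nonneg_left (sub_le_sub_left ?_ _) (Nat.cast_nonneg _))
    (half_numComponents_mul_le_expDrops (η := (2 * k * c + 1) / n) (rate := c * A / 8 / n ^ 2)
      (mu := A / n) (h := c * A / 4 / n ^ 3) hk (by positivity) ?_ (by positivity) hη ?_ ?_ ?_
      hδ hf0 hf1 hfs hsub (by positivity) ?_ _ x)
  · have h1 : c * A / 4 / n ^ 3 ≤ 1 := by
      rw [div_le_one (by positivity)]; linarith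
    refine (inv_one_add_pow_floor_le (by positivity) h1 ?_).trans (le_of_eq ?_)
    · have : 2 / ε ≤ n ^ 3 := by linarith
      rw [div_le_iff₀ hε] at this
      linarith
    · congr 2
      field_simp
      ring
  · rw [div_le_iff₀ hnpos]; linarith
  · have : (2 * k * c + 1) / n - 2 * k * (c / n) = n / n ^ 2 := by field_simp; ring
    rw [this]
    exact div_le_div_of_nonneg_right (by linarith) (by positivity)
  · have h1 : c * A / 8 / n ^ 2 ≤ 1 / 2 := by
      rw [div_le_iff₀ (by positivity)]; linarith
    have h2 : k * (c / n) ≤ 1 / 2 := by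
      rw [← mul_div_assoc, div_le_iff₀ hnpos]; linarith
    linarith
  · have h1 : c / n * ((1 - 1 / 2) / 2 * (A / n) - (2 * k * c + 1) / n * k) ≤
        c / n * ((1 - (2 * k * c + 1) / n) / 2 * (A / n) - (2 * k * c + 1) / n * k) := by
      gcongr
    refine le_trans ?_ h1
    have h2 : c / n * ((1 - 1 / 2) / 2 * (A / n) - (2 * k * c + 1) / n * k) =
        c * (A / 4 - k * (2 * k * c + 1)) / n ^ 2 := by field_simp; ring
    rw [h2]
    refine div_le_div_of_nonneg_right ?_ (by positivity)
    nlinarith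
  · rw [hn]
    refine le_of_eq ?_
    field_simp
    ring

/-- Lower bound on the number of collisions: for the KCIP on the torus
`Λ(L,d)` with `p = c/n` (`d ≥ 3`), for every `ε > 0` there exist `κ > 0`, `C < ∞` and `N`
(depending only on `ε, c, d`) such that for all `n = (L+1)^d > N` and every initial
configuration `x`: `E_x[#{0 ≤ u < ⌊εn³⌋ : Y_{u+1} < Y_u}] ≥ κ Y_0(x) − C`. -/
theorem kcip_collision_lower_bound (c : ℝ) (hc : 0 < c) (d : ℕ) (hd : 3 ≤ d)
    (ε : ℝ) (hε : 0 < ε) :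
    ∃ κ C : ℝ, 0 < κ ∧ ∃ N : ℕ,
      ∀ L : ℕ, N < (L + 1) ^ d →
      ∀ x : (Fin d → ZMod (L + 1)) → Bool,
        trajExp (kcipKernel (torusGraph (L + 1) d) (c / (((L + 1) ^ d : ℕ) : ℝ))) x
            (⌊ε * (((L + 1) ^ d : ℕ) : ℝ) ^ 3⌋₊)
            (fun ω =>
              ((Finset.univ.filter fun u : Fin ⌊ε * (((L + 1) ^ d : ℕ) : ℝ) ^ 3⌋₊ =>
                  numComponents (torusGraph (L + 1) d) (ω u.succ) <
                    numComponents (torusGraph (L + 1) d) (ω u.castSucc)).card : ℝ)) ≥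
          κ * (numComponents (torusGraph (L + 1) d) x : ℝ) - C := by
  obtain ⟨γ, hγ, hsol⟩ := exists_torus_subsolution hd
  obtain ⟨A, hA1, hA0, hAexp⟩ := exists_one_le_mul_exp_le (b := c * ε / 16)
    (δ := (1 / 4) ^ (2 * (2 * d)) * γ / 2) (by positivity) (by positivity)
    (8 * (2 * d : ℕ) * (2 * (2 * d : ℕ) * c + 1))
  obtain ⟨L₀, hL₀⟩ := hsol A hA1
  have hA : 0 < A := by linarith
  have hd0 : (0 : ℝ) < d := by exact_mod_cast (by omega : 0 < d)
  set δ : ℝ := (1 / 4) ^ (2 * (2 * d)) * (γ / A) with hδ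
  have hδ0 : 0 < δ := by positivity
  have hexp : Real.exp (-(c * ε / 16 * A)) ≤ δ / 2 := by
    refine hAexp.trans (le_of_eq ?_)
    rw [hδ]; ring
  set M : ℝ := 1 + 2 * c + 2 * (2 * (2 * d : ℕ) * c + 1) + c * A / 4 + 2 / ε with hM
  refine ⟨δ / (16 * d), δ / (16 * d), by positivity, max ⌈M⌉₊ (max ⌈L₀⌉₊ 3 ^ d),
    fun L hL x => ?_⟩
  have hLM : M ≤ (((L + 1) ^ d : ℕ) : ℝ) :=
    Nat.ceil_le.1 ((le_max_left _ _).trans hL.le)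
  have hLL : max ⌈L₀⌉₊ 3 < L + 1 := lt_of_pow_lt_pow_left₀ d (Nat.zero_le _)
    ((le_max_right _ _).trans_lt hL)
  have hL3 : 3 ≤ L + 1 := (le_max_right _ _).trans hLL.le
  obtain ⟨f, hf0, hf1, hfs, hf⟩ := hL₀ (L + 1)
    (Nat.ceil_le.1 ((le_max_left _ _).trans hLL.le))
  have key := half_numComponents_mul_le_expDrops_of_scaling (G := torusGraph (L + 1) d)
    (k := 2 * d) (c := c) (ε := ε) (A := A) (n := (((L + 1) ^ d : ℕ) : ℝ))
    (f := fun u t => f (u - t)) (δ := γ / A) (by simp [ZMod.card]) hc hε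
    (card_filter_torusGraph_adj_le hL3) hA0 hA.le hLM (by positivity) (fun s t => hf0 _)
    (fun s t => hf1 _) (fun s t => by rw [← hfs, neg_sub])
    (fun a t hat => by
      rw [sum_torusGraph_adj_sub hL3]
      have := hf (a - t) (sub_ne_zero.2 hat)
      push_cast at this ⊢
      exact this) x
  rw [← hδ] at key
  set Y := numComponents (torusGraph (L + 1) d) x
  have hY : (Y : ℝ) - 1 ≤ 2 * ((Y / 2 : ℕ) : ℝ) := by
    have : Y ≤ 2 * (Y / 2) + 1 := by omega
    have : (Y : ℝ) ≤ 2 * ((Y / 2 : ℕ) : ℝ) + 1 := by exact_mod_cast this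
    linarith
  suffices h : ∀ E : ℝ, ((Y / 2 : ℕ) : ℝ) * (δ - Real.exp (-(c * ε / 16 * A))) ≤
      2 * (2 * d : ℕ) * E → δ / (16 * d) * Y - δ / (16 * d) ≤ E by
    refine (h _ key).trans (le_of_eq ?_)
    unfold expDrops
    congr!
  intro E hE
  have h1 := mul_le_mul_of_nonneg_left hexp (Nat.cast_nonneg (α := ℝ) (Y / 2))
  have h2 := mul_le_mul_of_nonneg_right hY hδ0.le
  rw [← mul_sub_one, div_mul_eq_mul_div, div_le_iff₀ (by positivity)]
  push_cast at hE
  linarith
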